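/- arXiv:1611.09513 — 5 statements merged into one kernel-verified Lean document; each statement's English description precedes it below -/
import Mathlib

section
/- Let t ∈ ℝ with t ∉ {−1,0,1}. The ten pairs in the list Z_t = {((1,1,1),(1,1,1)), ((1,1,−1),(1,1,−1)), ((1,−1,1),(1,−1,1)), ((−1,1,1),(−1,1,1)), ((1,t,0),(t,1,0)), ((1,−t,0),(−t,1,0)), ((0,1,t),(0,t,1)), ((0,1,−t),(0,−t,1)), ((t,0,1),(1,0,t)), ((−t,0,1),(1,0,−t))} determine ten pairwise distinct points of ℙ² × ℙ², and the set of zeros of p_t in ℙ² × ℙ² is exactly this ten-element set; in particular there exists a biquadratic form in (x₁,x₂,x₃) and (y₁,y₂,y₃) that is nonnegative on ℝ³ × ℝ³ and has exactly 10 real zeros in ℙ² × ℙ². -/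
open MvPolynomial

/-- The biquadratic form `p_t(x, y) = yᵀ Φ_t(xxᵀ) y`. -/
def pform (t : ℝ) (x y : Fin 3 → ℝ) : ℝ :=
  ((t^2-1)^2 * x 0^2 + x 1^2 + t^4 * x 2^2) * y 0^2 +
  ((t^2-1)^2 * x 1^2 + x 2^2 + t^4 * x 0^2) * y 1^2 +
  ((t^2-1)^2 * x 2^2 + x 0^2 + t^4 * x 1^2) * y 2^2 -
  2 * (t^4-t^2+1) * (x 0 * x 1 * y 0 * y 1 + x 0 * x 2 * y 0 * y 2 + x 1 * x 2 * y 1 * y 2)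

/-- The ten pairs of vectors giving the zeros of `p_t` in `ℙ² × ℙ²`. -/
def Zlist (t : ℝ) : List ((Fin 3 → ℝ) × (Fin 3 → ℝ)) :=
  [(![1, 1, 1], ![1, 1, 1]), (![1, 1, -1], ![1, 1, -1]),
   (![1, -1, 1], ![1, -1, 1]), (![-1, 1, 1], ![-1, 1, 1]),
   (![1, t, 0], ![t, 1, 0]), (![1, -t, 0], ![-t, 1, 0]),
   (![0, 1, t], ![0, t, 1]), (![0, 1, -t], ![0, -t, 1]),
   (![t, 0, 1], ![1, 0, t]), (![-t, 0, 1], ![1, 0, -t])]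

/-- A biquadratic form in `x = (x₁,x₂,x₃)` and `y = (y₁,y₂,y₃)`: a real polynomial in six
variables that is homogeneous of degree `2` in the `x`-variables and of degree `2` in the
`y`-variables. -/
def IsBiquadratic (q : MvPolynomial (Fin 3 ⊕ Fin 3) ℝ) : Prop :=
  q.IsWeightedHomogeneous (Sum.elim (fun _ => 1) (fun _ => 0)) 2 ∧
  q.IsWeightedHomogeneous (Sum.elim (fun _ => 0) (fun _ => 1)) 2

/-- The cyclic cubic form governing the nonnegativity of `pform`. -/
def cyclicCubic (s a b c : ℝ) : ℝ :=
  s ^ 2 * (a ^ 3 + b ^ 3 + c ^ 3) + (s ^ 4 - 2 * s) * (a ^ 2 * b + b ^ 2 * c + c ^ 2 * a) +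
    (1 - 2 * s ^ 3) * (a * b ^ 2 + b * c ^ 2 + c * a ^ 2) -
    3 * (s ^ 2 + (s ^ 4 - 2 * s) + (1 - 2 * s ^ 3)) * (a * b * c)

theorem cyclicCubic_rotate (s a b c : ℝ) : cyclicCubic s b c a = cyclicCubic s a b c := by
  unfold cyclicCubic; ring

theorem cyclicCubic_eq (s a b c : ℝ) :
    cyclicCubic s a b c =
      c * (s ^ 2 - s + 1) ^ 2 * ((a - c) ^ 2 - (a - c) * (b - c) + (b - c) ^ 2) +
        (s * (a - c) - (b - c)) ^ 2 * ((a - c) + s ^ 2 * (b - c)) := by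
  unfold cyclicCubic; ring

theorem cyclicCubic_of_min {s a b c : ℝ} (hs : 0 < s) (hc : 0 ≤ c) (hca : c ≤ a) (hcb : c ≤ b) :
    0 ≤ cyclicCubic s a b c ∧
      (cyclicCubic s a b c = 0 → (a = c ∧ b = c) ∨ (c = 0 ∧ b = s * a)) := by
  have hk : 0 < (s ^ 2 - s + 1) ^ 2 := by
    have : 0 < s ^ 2 - s + 1 := by nlinarith [sq_nonneg (s - 1 / 2)]
    positivity
  have hpq : 0 ≤ (a - c) ^ 2 - (a - c) * (b - c) + (b - c) ^ 2 := by
    nlinarith [sq_nonneg ((a - c) - (b - c)), sq_nonneg (a - c), sq_nonneg (b - c)]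
  have ha : 0 ≤ a - c := sub_nonneg.2 hca
  have hb : 0 ≤ b - c := sub_nonneg.2 hcb
  have h₁ : 0 ≤ c * (s ^ 2 - s + 1) ^ 2 * ((a - c) ^ 2 - (a - c) * (b - c) + (b - c) ^ 2) := by
    positivity
  have h₂ : 0 ≤ (s * (a - c) - (b - c)) ^ 2 * ((a - c) + s ^ 2 * (b - c)) := by positivity
  rw [cyclicCubic_eq]
  refine ⟨add_nonneg h₁ h₂, fun h => ?_⟩
  obtain ⟨e₁, e₂⟩ := (add_eq_zero_iff_of_nonneg h₁ h₂).1 h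
  have diag : (a - c) + s ^ 2 * (b - c) = 0 → a = c ∧ b = c := fun h₀ => by
    have hb' : 0 ≤ s ^ 2 * (b - c) := by positivity
    obtain ⟨i, j⟩ := (add_eq_zero_iff_of_nonneg ha hb').1 h₀
    refine ⟨sub_eq_zero.1 i, sub_eq_zero.1 ?_⟩
    exact (mul_eq_zero.1 j).resolve_left (by positivity)
  rcases mul_eq_zero.1 e₂ with e | e
  · have hq : b - c = s * (a - c) := by linarith [pow_eq_zero_iff (two_ne_zero) |>.1 e]
    rcases hc.eq_or_lt with rfl | hc'
    · right; simpa using hq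
    · left
      have e₃ := (mul_eq_zero.1 e₁).resolve_left (by positivity)
      have : a - c = 0 ∧ b - c = 0 := by
        constructor <;> refine pow_eq_zero_iff (two_ne_zero) |>.1 ?_ <;>
          nlinarith [sq_nonneg ((a - c) - (b - c)), sq_nonneg (a - c), sq_nonneg (b - c)]
      exact ⟨by linarith [this.1], by linarith [this.2]⟩
  · exact Or.inl (diag e)

theorem cyclicCubic_nonneg_and_eq_zero {s a b c : ℝ} (hs : 0 < s)
    (ha : 0 ≤ a) (hb : 0 ≤ b) (hc : 0 ≤ c) :
    0 ≤ cyclicCubic s a b c ∧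
      (cyclicCubic s a b c = 0 → (a = b ∧ b = c) ∨ (c = 0 ∧ b = s * a) ∨
        (a = 0 ∧ c = s * b) ∨ (b = 0 ∧ a = s * c)) := by
  have r₁ := cyclicCubic_rotate s a b c
  have r₂ := cyclicCubic_rotate s b c a
  rcases le_total a b with h₁ | h₁ <;> rcases le_total b c with h₂ | h₂ <;>
    rcases le_total a c with h₃ | h₃
  all_goals
    first
    | have := cyclicCubic_of_min hs hc (by linarith : c ≤ a) (by linarith : c ≤ b); grind
    | have := cyclicCubic_of_min hs ha (by linarith : a ≤ b) (by linarith : a ≤ c); grind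
    | have := cyclicCubic_of_min hs hb (by linarith : b ≤ c) (by linarith : b ≤ a); grind

theorem mul_quadratic_sub_sq_eq (k E₀ E₁ E₂ a b c u v w : ℝ) :
    E₀ * E₁ * E₂ * (E₀ * u ^ 2 + E₁ * v ^ 2 + E₂ * w ^ 2 - k * (a * u + b * v + c * w) ^ 2) =
      E₁ * E₂ * (E₀ * u - k * (a * u + b * v + c * w) * a) ^ 2 +
      E₀ * E₂ * (E₁ * v - k * (a * u + b * v + c * w) * b) ^ 2 +
      E₀ * E₁ * (E₂ * w - k * (a * u + b * v + c * w) * c) ^ 2 +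
      k * (a * u + b * v + c * w) ^ 2 *
        (E₀ * E₁ * E₂ - k * (a ^ 2 * (E₁ * E₂) + b ^ 2 * (E₀ * E₂) + c ^ 2 * (E₀ * E₁))) := by
  ring

/-- The diagonal coefficients in `pform t x y = ∑ i, E i * y i ^ 2 - k * (∑ i, x i * y i) ^ 2`. -/
def diagCoeff (t a b c : ℝ) : ℝ :=
  (2 * t ^ 4 - 3 * t ^ 2 + 2) * a ^ 2 + b ^ 2 + t ^ 4 * c ^ 2

theorem diagCoeff_det (t a b c : ℝ) :
    diagCoeff t a b c * diagCoeff t b c a * diagCoeff t c a b -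
      (t ^ 4 - t ^ 2 + 1) * (a ^ 2 * (diagCoeff t b c a * diagCoeff t c a b) +
        b ^ 2 * (diagCoeff t a b c * diagCoeff t c a b) +
        c ^ 2 * (diagCoeff t a b c * diagCoeff t b c a)) =
      (t ^ 2 - 1) ^ 2 * cyclicCubic (t ^ 2) (a ^ 2) (b ^ 2) (c ^ 2) := by
  unfold diagCoeff cyclicCubic; ring

theorem pform_eq (t : ℝ) (x y : Fin 3 → ℝ) :
    pform t x y = diagCoeff t (x 0) (x 1) (x 2) * y 0 ^ 2 + diagCoeff t (x 1) (x 2) (x 0) * y 1 ^ 2 +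
      diagCoeff t (x 2) (x 0) (x 1) * y 2 ^ 2 -
      (t ^ 4 - t ^ 2 + 1) * (x 0 * y 0 + x 1 * y 1 + x 2 * y 2) ^ 2 := by
  unfold pform diagCoeff; ring

theorem diagCoeff_pos {t a b c : ℝ} (ht : t ≠ 0) (h : a ≠ 0 ∨ b ≠ 0 ∨ c ≠ 0) :
    0 < diagCoeff t a b c := by
  have hα : 0 < 2 * t ^ 4 - 3 * t ^ 2 + 2 := by nlinarith [sq_nonneg (t ^ 2 - 3 / 4)]
  unfold diagCoeff
  rcases h with h | h | h <;> positivity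

theorem offdiag_pos (t : ℝ) : 0 < t ^ 4 - t ^ 2 + 1 := by
  nlinarith [sq_nonneg (t ^ 2 - 1 / 2)]

theorem ne_zero_fin_three {x : Fin 3 → ℝ} (h : x ≠ 0) : x 0 ≠ 0 ∨ x 1 ≠ 0 ∨ x 2 ≠ 0 := by
  contrapose! h
  ext i; fin_cases i <;> simp [h]

theorem pform_nonneg {t : ℝ} (ht : t ≠ 0) (x y : Fin 3 → ℝ) : 0 ≤ pform t x y := by
  by_cases hx : x = 0
  · simp [hx, pform]
  have hx := ne_zero_fin_three hx
  have h₀ : 0 < diagCoeff t (x 0) (x 1) (x 2) := diagCoeff_pos ht hx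
  have h₁ : 0 < diagCoeff t (x 1) (x 2) (x 0) := diagCoeff_pos ht (by tauto)
  have h₂ : 0 < diagCoeff t (x 2) (x 0) (x 1) := diagCoeff_pos ht (by tauto)
  have hk := offdiag_pos t
  have hG := (cyclicCubic_nonneg_and_eq_zero (s := t ^ 2) (by positivity)
    (sq_nonneg (x 0)) (sq_nonneg (x 1)) (sq_nonneg (x 2))).1
  refine nonneg_of_mul_nonneg_right (b := pform t x y) ?_ (mul_pos (mul_pos h₀ h₁) h₂)
  rw [pform_eq, mul_quadratic_sub_sq_eq, diagCoeff_det]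
  positivity

theorem of_pform_eq_zero {t : ℝ} (ht : t ≠ 0) (ht' : t ^ 2 ≠ 1) {x y : Fin 3 → ℝ}
    (hx : x ≠ 0) (hy : y ≠ 0) (h : pform t x y = 0) :
    cyclicCubic (t ^ 2) (x 0 ^ 2) (x 1 ^ 2) (x 2 ^ 2) = 0 ∧ ∃ r : ℝ, r ≠ 0 ∧
      diagCoeff t (x 0) (x 1) (x 2) * y 0 = r * x 0 ∧
      diagCoeff t (x 1) (x 2) (x 0) * y 1 = r * x 1 ∧
      diagCoeff t (x 2) (x 0) (x 1) * y 2 = r * x 2 := by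
  have hx := ne_zero_fin_three hx
  have hy := ne_zero_fin_three hy
  have h₀ : 0 < diagCoeff t (x 0) (x 1) (x 2) := diagCoeff_pos ht hx
  have h₁ : 0 < diagCoeff t (x 1) (x 2) (x 0) := diagCoeff_pos ht (by tauto)
  have h₂ : 0 < diagCoeff t (x 2) (x 0) (x 1) := diagCoeff_pos ht (by tauto)
  have hk := offdiag_pos t
  have hG := (cyclicCubic_nonneg_and_eq_zero (s := t ^ 2) (by positivity)
    (sq_nonneg (x 0)) (sq_nonneg (x 1)) (sq_nonneg (x 2))).1
  have key := mul_quadratic_sub_sq_eq (t ^ 4 - t ^ 2 + 1) (diagCoeff t (x 0) (x 1) (x 2))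
    (diagCoeff t (x 1) (x 2) (x 0)) (diagCoeff t (x 2) (x 0) (x 1)) (x 0) (x 1) (x 2)
    (y 0) (y 1) (y 2)
  rw [← pform_eq, h, mul_zero, diagCoeff_det] at key
  generalize diagCoeff t (x 0) (x 1) (x 2) = E₀ at *
  generalize diagCoeff t (x 1) (x 2) (x 0) = E₁ at *
  generalize diagCoeff t (x 2) (x 0) (x 1) = E₂ at *
  generalize cyclicCubic (t ^ 2) (x 0 ^ 2) (x 1 ^ 2) (x 2 ^ 2) = G at *
  generalize t ^ 4 - t ^ 2 + 1 = k at *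
  generalize x 0 * y 0 + x 1 * y 1 + x 2 * y 2 = w at *
  have n₀ : 0 ≤ E₁ * E₂ * (E₀ * y 0 - k * w * x 0) ^ 2 := by positivity
  have n₁ : 0 ≤ E₀ * E₂ * (E₁ * y 1 - k * w * x 1) ^ 2 := by positivity
  have n₂ : 0 ≤ E₀ * E₁ * (E₂ * y 2 - k * w * x 2) ^ 2 := by positivity
  have n₃ : 0 ≤ k * w ^ 2 * ((t ^ 2 - 1) ^ 2 * G) := by positivity
  have z₀ : E₁ * E₂ * (E₀ * y 0 - k * w * x 0) ^ 2 = 0 := by linarith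
  have z₁ : E₀ * E₂ * (E₁ * y 1 - k * w * x 1) ^ 2 = 0 := by linarith
  have z₂ : E₀ * E₁ * (E₂ * y 2 - k * w * x 2) ^ 2 = 0 := by linarith
  have z₃ : k * w ^ 2 * ((t ^ 2 - 1) ^ 2 * G) = 0 := by linarith
  simp only [mul_eq_zero, h₀.ne', h₁.ne', h₂.ne', hk.ne', false_or, or_self, ne_eq, two_ne_zero,
    not_false_eq_true, pow_eq_zero_iff, sub_eq_zero, ht'] at z₀ z₁ z₂ z₃
  have hw : w ≠ 0 := by
    rintro rfl
    simp [h₀.ne', h₁.ne', h₂.ne'] at z₀ z₁ z₂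
    tauto
  exact ⟨z₃.resolve_left hw, k * w, mul_ne_zero hk.ne' hw, z₀, z₁, z₂⟩

theorem edge_zero {t a b u v r : ℝ} (ht : t ≠ 0) (ha : a ≠ 0) (hr : r ≠ 0)
    (hab : b ^ 2 = t ^ 2 * a ^ 2) (hu : diagCoeff t a b 0 * u = r * a)
    (hv : diagCoeff t b 0 a * v = r * b) :
    v ≠ 0 ∧ ((b = a * t ∧ u = v * t) ∨ (b = a * -t ∧ u = v * -t)) := by
  have hk := offdiag_pos t
  have e₀ : diagCoeff t a b 0 = 2 * (t ^ 4 - t ^ 2 + 1) * a ^ 2 := by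
    unfold diagCoeff; rw [hab]; ring
  have e₁ : diagCoeff t b 0 a = 2 * (t ^ 4 - t ^ 2 + 1) * t ^ 2 * a ^ 2 := by
    unfold diagCoeff; rw [hab]; ring
  rw [e₀] at hu
  rw [e₁] at hv
  generalize t ^ 4 - t ^ 2 + 1 = k at *
  have hka : 2 * k * a ^ 2 * t ≠ 0 := by positivity
  have hb : b ≠ 0 := by
    rintro rfl
    have : t ^ 2 * a ^ 2 ≠ 0 := by positivity
    exact this (by simpa using hab.symm)
  refine ⟨fun h => mul_ne_zero hr hb (by rw [← hv, h, mul_zero]), ?_⟩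
  have : b ^ 2 = (a * t) ^ 2 := by rw [hab]; ring
  rcases sq_eq_sq_iff_eq_or_eq_neg.1 this with h | h
  · refine Or.inl ⟨h, mul_left_cancel₀ hka ?_⟩
    rw [h] at hv; linear_combination t * hu - hv
  · refine Or.inr ⟨by rw [h]; ring, mul_left_cancel₀ hka ?_⟩
    rw [h] at hv; linear_combination t * hu + hv

theorem eq_smul_vec {x : Fin 3 → ℝ} {c a₀ a₁ a₂ : ℝ} (hc : c ≠ 0) (h₀ : x 0 = c * a₀)
    (h₁ : x 1 = c * a₁) (h₂ : x 2 = c * a₂) : ∃ c : ℝ, c ≠ 0 ∧ x = c • ![a₀, a₁, a₂] :=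
  ⟨c, hc, by ext i; fin_cases i <;> simp [h₀, h₁, h₂]⟩

theorem mem_Zlist_of_pform_eq_zero {t : ℝ} (ht : t ≠ 0) (ht' : t ^ 2 ≠ 1) {x y : Fin 3 → ℝ}
    (hx : x ≠ 0) (hy : y ≠ 0) (h : pform t x y = 0) :
    ∃ uv ∈ Zlist t, (∃ c : ℝ, c ≠ 0 ∧ x = c • uv.1) ∧ (∃ d : ℝ, d ≠ 0 ∧ y = d • uv.2) := by
  obtain ⟨hG, r, hr, h₀, h₁, h₂⟩ := of_pform_eq_zero ht ht' hx hy h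
  have hx := ne_zero_fin_three hx
  rcases (cyclicCubic_nonneg_and_eq_zero (s := t ^ 2) (by positivity)
    (sq_nonneg (x 0)) (sq_nonneg (x 1)) (sq_nonneg (x 2))).2 hG with
    ⟨e₁, e₂⟩ | ⟨e₁, e₂⟩ | ⟨e₁, e₂⟩ | ⟨e₁, e₂⟩
  · have hx0 : x 0 ≠ 0 := by
      intro h
      have i₁ : x 1 = 0 := by simpa [h] using e₁.symm
      have i₂ : x 2 = 0 := by simpa [i₁] using e₂.symm
      tauto
    have d₁ : diagCoeff t (x 1) (x 2) (x 0) = diagCoeff t (x 0) (x 1) (x 2) := by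
      unfold diagCoeff; rw [← e₂, ← e₁]
    have d₂ : diagCoeff t (x 2) (x 0) (x 1) = diagCoeff t (x 0) (x 1) (x 2) := by
      unfold diagCoeff; rw [← e₂, ← e₁]
    have hE : diagCoeff t (x 0) (x 1) (x 2) ≠ 0 := (diagCoeff_pos ht hx).ne'
    rw [d₁] at h₁
    rw [d₂] at h₂
    generalize diagCoeff t (x 0) (x 1) (x 2) = E at *
    have hy0 : y 0 ≠ 0 := fun h => mul_ne_zero hr hx0 (by rw [← h₀, h, mul_zero])
    have f₁ : x 1 = x 0 ∧ y 1 = y 0 ∨ x 1 = -x 0 ∧ y 1 = -y 0 := by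
      refine (sq_eq_sq_iff_eq_or_eq_neg.1 e₁.symm).imp (fun h => ⟨h, mul_left_cancel₀ hE ?_⟩)
        (fun h => ⟨h, mul_left_cancel₀ hE ?_⟩)
      · rw [h₁, h₀, h]
      · rw [h₁, h]; linear_combination h₀
    have f₂ : x 2 = x 0 ∧ y 2 = y 0 ∨ x 2 = -x 0 ∧ y 2 = -y 0 := by
      refine (sq_eq_sq_iff_eq_or_eq_neg.1 (e₁.trans e₂).symm).imp
        (fun h => ⟨h, mul_left_cancel₀ hE ?_⟩) (fun h => ⟨h, mul_left_cancel₀ hE ?_⟩)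
      · rw [h₂, h₀, h]
      · rw [h₂, h]; linear_combination h₀
    rcases f₁ with ⟨i₁, j₁⟩ | ⟨i₁, j₁⟩ <;> rcases f₂ with ⟨i₂, j₂⟩ | ⟨i₂, j₂⟩
    · exact ⟨(![1, 1, 1], ![1, 1, 1]), by simp [Zlist],
        eq_smul_vec hx0 (by simp) (by simp [i₁]) (by simp [i₂]),
        eq_smul_vec hy0 (by simp) (by simp [j₁]) (by simp [j₂])⟩
    · exact ⟨(![1, 1, -1], ![1, 1, -1]), by simp [Zlist],
        eq_smul_vec hx0 (by simp) (by simp [i₁]) (by simp [i₂]),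
        eq_smul_vec hy0 (by simp) (by simp [j₁]) (by simp [j₂])⟩
    · exact ⟨(![1, -1, 1], ![1, -1, 1]), by simp [Zlist],
        eq_smul_vec hx0 (by simp) (by simp [i₁]) (by simp [i₂]),
        eq_smul_vec hy0 (by simp) (by simp [j₁]) (by simp [j₂])⟩
    · exact ⟨(![-1, 1, 1], ![-1, 1, 1]), by simp [Zlist],
        eq_smul_vec (neg_ne_zero.2 hx0) (by simp) (by simp [i₁]) (by simp [i₂]),
        eq_smul_vec (neg_ne_zero.2 hy0) (by simp) (by simp [j₁]) (by simp [j₂])⟩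
  · have hz : x 2 = 0 := by simpa using e₁
    have hx0 : x 0 ≠ 0 := by intro h; simp [h] at e₂; simp_all
    have hE : diagCoeff t (x 2) (x 0) (x 1) ≠ 0 := (diagCoeff_pos ht (by tauto)).ne'
    have hy2 : y 2 = 0 := by
      rw [show r * x 2 = 0 by rw [hz, mul_zero]] at h₂
      exact (mul_eq_zero.1 h₂).resolve_left hE
    rw [hz] at h₀ h₁
    obtain ⟨hv, ⟨i, j⟩ | ⟨i, j⟩⟩ := edge_zero ht hx0 hr e₂ h₀ h₁
    · exact ⟨(![1, t, 0], ![t, 1, 0]), by simp [Zlist],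
        eq_smul_vec hx0 (by simp) i (by simp [hz]), eq_smul_vec hv j (by simp) (by simp [hy2])⟩
    · exact ⟨(![1, -t, 0], ![-t, 1, 0]), by simp [Zlist],
        eq_smul_vec hx0 (by simp) i (by simp [hz]), eq_smul_vec hv j (by simp) (by simp [hy2])⟩
  · have hz : x 0 = 0 := by simpa using e₁
    have hx1 : x 1 ≠ 0 := by intro h; simp [h] at e₂; simp_all
    have hE : diagCoeff t (x 0) (x 1) (x 2) ≠ 0 := (diagCoeff_pos ht (by tauto)).ne'
    have hy0 : y 0 = 0 := by
      rw [show r * x 0 = 0 by rw [hz, mul_zero]] at h₀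
      exact (mul_eq_zero.1 h₀).resolve_left hE
    rw [hz] at h₁ h₂
    obtain ⟨hv, ⟨i, j⟩ | ⟨i, j⟩⟩ := edge_zero ht hx1 hr e₂ h₁ h₂
    · exact ⟨(![0, 1, t], ![0, t, 1]), by simp [Zlist],
        eq_smul_vec hx1 (by simp [hz]) (by simp) i, eq_smul_vec hv (by simp [hy0]) j (by simp)⟩
    · exact ⟨(![0, 1, -t], ![0, -t, 1]), by simp [Zlist],
        eq_smul_vec hx1 (by simp [hz]) (by simp) i, eq_smul_vec hv (by simp [hy0]) j (by simp)⟩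
  · have hz : x 1 = 0 := by simpa using e₁
    have hx2 : x 2 ≠ 0 := by intro h; simp [h] at e₂; simp_all
    have hE : diagCoeff t (x 1) (x 2) (x 0) ≠ 0 := (diagCoeff_pos ht (by tauto)).ne'
    have hy1 : y 1 = 0 := by
      rw [show r * x 1 = 0 by rw [hz, mul_zero]] at h₁
      exact (mul_eq_zero.1 h₁).resolve_left hE
    rw [hz] at h₀ h₂
    obtain ⟨hv, ⟨i, j⟩ | ⟨i, j⟩⟩ := edge_zero ht hx2 hr e₂ h₂ h₀
    · exact ⟨(![t, 0, 1], ![1, 0, t]), by simp [Zlist],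
        eq_smul_vec hx2 i (by simp [hz]) (by simp), eq_smul_vec hv (by simp) (by simp [hy1]) j⟩
    · exact ⟨(![-t, 0, 1], ![1, 0, -t]), by simp [Zlist],
        eq_smul_vec hx2 i (by simp [hz]) (by simp), eq_smul_vec hv (by simp) (by simp [hy1]) j⟩

theorem pform_smul_smul (t c d : ℝ) (x y : Fin 3 → ℝ) :
    pform t (c • x) (d • y) = c ^ 2 * d ^ 2 * pform t x y := by
  simp only [pform, Pi.smul_apply, smul_eq_mul]; ring

theorem pform_eq_zero_of_mem_Zlist {t : ℝ} {uv : (Fin 3 → ℝ) × (Fin 3 → ℝ)} (h : uv ∈ Zlist t) :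
    pform t uv.1 uv.2 = 0 := by
  simp only [Zlist, List.mem_cons, List.not_mem_nil, or_false] at h
  rcases h with rfl | rfl | rfl | rfl | rfl | rfl | rfl | rfl | rfl | rfl <;>
    simp [pform] <;> ring

theorem pform_eq_zero_iff {t : ℝ} (ht : t ≠ 0) (ht' : t ^ 2 ≠ 1) {x y : Fin 3 → ℝ}
    (hx : x ≠ 0) (hy : y ≠ 0) :
    pform t x y = 0 ↔
      ∃ uv ∈ Zlist t, (∃ c : ℝ, c ≠ 0 ∧ x = c • uv.1) ∧ (∃ d : ℝ, d ≠ 0 ∧ y = d • uv.2) := by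
  refine ⟨mem_Zlist_of_pform_eq_zero ht ht' hx hy, ?_⟩
  rintro ⟨uv, huv, ⟨c, -, rfl⟩, ⟨d, -, rfl⟩⟩
  rw [pform_smul_smul, pform_eq_zero_of_mem_Zlist huv, mul_zero]

theorem Zlist_ne_zero {t : ℝ} {uv : (Fin 3 → ℝ) × (Fin 3 → ℝ)} (h : uv ∈ Zlist t) :
    uv.1 ≠ 0 ∧ uv.2 ≠ 0 := by
  simp only [Zlist, List.mem_cons, List.not_mem_nil, or_false] at h
  rcases h with rfl | rfl | rfl | rfl | rfl | rfl | rfl | rfl | rfl | rfl <;> simp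

theorem Zlist_pairwise {t : ℝ} (ht : t ≠ 0) :
    (Zlist t).Pairwise fun a b =>
      ¬ ((∃ c : ℝ, c ≠ 0 ∧ b.1 = c • a.1) ∧ (∃ d : ℝ, d ≠ 0 ∧ b.2 = d • a.2)) := by
  have ht2 : t ≠ -t := fun h => ht (by linarith)
  simp only [Zlist, List.pairwise_cons, List.mem_cons, List.not_mem_nil, or_false,
    forall_eq_or_imp, forall_eq]
  simp [funext_iff, Fin.forall_fin_succ]
  grind

/-- The biquadratic form `pform t` as a polynomial in six variables. -/
noncomputable def pformPoly (t : ℝ) : MvPolynomial (Fin 3 ⊕ Fin 3) ℝ :=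
  let m (c : ℝ) (i j k l : Fin 3) : MvPolynomial (Fin 3 ⊕ Fin 3) ℝ :=
    C c * (X (.inl i) * X (.inl j)) * (X (.inr k) * X (.inr l))
  m ((t ^ 2 - 1) ^ 2) 0 0 0 0 + m 1 1 1 0 0 + m (t ^ 4) 2 2 0 0 +
  m ((t ^ 2 - 1) ^ 2) 1 1 1 1 + m 1 2 2 1 1 + m (t ^ 4) 0 0 1 1 +
  m ((t ^ 2 - 1) ^ 2) 2 2 2 2 + m 1 0 0 2 2 + m (t ^ 4) 1 1 2 2 +
  m (-2 * (t ^ 4 - t ^ 2 + 1)) 0 1 0 1 + m (-2 * (t ^ 4 - t ^ 2 + 1)) 0 2 0 2 +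
  m (-2 * (t ^ 4 - t ^ 2 + 1)) 1 2 1 2

theorem eval_pformPoly (t : ℝ) (x y : Fin 3 → ℝ) :
    eval (Sum.elim x y) (pformPoly t) = pform t x y := by
  simp [pformPoly, pform]; ring

theorem IsBiquadratic.add {p q : MvPolynomial (Fin 3 ⊕ Fin 3) ℝ} (hp : IsBiquadratic p)
    (hq : IsBiquadratic q) : IsBiquadratic (p + q) :=
  ⟨hp.1.add hq.1, hp.2.add hq.2⟩

theorem isBiquadratic_monomial (c : ℝ) (i j k l : Fin 3) :
    IsBiquadratic (C c * (X (.inl i) * X (.inl j)) * (X (.inr k) * X (.inr l))) := by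
  constructor
  all_goals
    have hX := isWeightedHomogeneous_X ℝ (σ := Fin 3 ⊕ Fin 3) (M := ℕ)
    convert ((isWeightedHomogeneous_C _ c).mul ((hX _ (.inl i)).mul (hX _ (.inl j)))).mul
      ((hX _ (.inr k)).mul (hX _ (.inr l))) using 1
    simp

theorem isBiquadratic_pformPoly (t : ℝ) : IsBiquadratic (pformPoly t) := by
  unfold pformPoly
  repeat' apply IsBiquadratic.add
  all_goals apply isBiquadratic_monomial

/-- The points of `ℙ² × ℙ²` represented by the pairs in `Zlist t`. -/
noncomputable def projZlist (t : ℝ) :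
    List (Projectivization ℝ (Fin 3 → ℝ) × Projectivization ℝ (Fin 3 → ℝ)) :=
  (Zlist t).pmap (fun uv h => (.mk ℝ uv.1 h.1, .mk ℝ uv.2 h.2)) fun _ => Zlist_ne_zero

theorem mk_eq_mk_iff_exists_ne_zero {v w : Fin 3 → ℝ} (hv : v ≠ 0) (hw : w ≠ 0) :
    Projectivization.mk ℝ v hv = Projectivization.mk ℝ w hw ↔ ∃ c : ℝ, c ≠ 0 ∧ v = c • w := by
  rw [Projectivization.mk_eq_mk_iff']
  constructor
  · rintro ⟨c, rfl⟩
    exact ⟨c, fun h => hv (by simp [h]), rfl⟩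
  · rintro ⟨c, -, rfl⟩
    exact ⟨c, rfl⟩

theorem projZlist_nodup {t : ℝ} (ht : t ≠ 0) : (projZlist t).Nodup := by
  refine List.Pairwise.pmap (Zlist_pairwise ht) _ fun a ha b hb h e => h ?_
  obtain ⟨e₁, e₂⟩ := Prod.ext_iff.1 e.symm
  exact ⟨(mk_eq_mk_iff_exists_ne_zero _ _).1 e₁, (mk_eq_mk_iff_exists_ne_zero _ _).1 e₂⟩

theorem mem_projZlist_iff {t : ℝ} (ht : t ≠ 0) (ht' : t ^ 2 ≠ 1)
    (z : Projectivization ℝ (Fin 3 → ℝ) × Projectivization ℝ (Fin 3 → ℝ)) :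
    z ∈ projZlist t ↔ pform t z.1.rep z.2.rep = 0 := by
  rw [pform_eq_zero_iff ht ht' z.1.rep_nonzero z.2.rep_nonzero, projZlist, List.mem_pmap]
  refine exists_congr fun uv => ?_
  constructor
  · rintro ⟨h, e⟩
    obtain ⟨e₁, e₂⟩ := Prod.ext_iff.1 e.symm
    rw [← z.1.mk_rep] at e₁
    rw [← z.2.mk_rep] at e₂
    exact ⟨h, (mk_eq_mk_iff_exists_ne_zero _ _).1 e₁, (mk_eq_mk_iff_exists_ne_zero _ _).1 e₂⟩
  · rintro ⟨h, h₁, h₂⟩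
    refine ⟨h, Prod.ext ?_ ?_⟩
    · conv_rhs => rw [← z.1.mk_rep]
      exact ((mk_eq_mk_iff_exists_ne_zero _ _).2 h₁).symm
    · conv_rhs => rw [← z.2.mk_rep]
      exact ((mk_eq_mk_iff_exists_ne_zero _ _).2 h₂).symm

/-- For `t ∉ {-1, 0, 1}`: the ten pairs of the list `Z_t` are pairwise distinct as points of
`ℙ² × ℙ²`, the zero set of `p_t` in `ℙ² × ℙ²` is exactly this ten-element set, and in
particular there is a biquadratic form, nonnegative on `ℝ³ × ℝ³`, having exactly `10` real
zeros in `ℙ² × ℙ²`. -/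
theorem pform_ten_zeros (t : ℝ) (ht : t ∉ ({-1, 0, 1} : Set ℝ)) :
    ((Zlist t).Pairwise fun a b =>
      ¬ ((∃ c : ℝ, c ≠ 0 ∧ b.1 = c • a.1) ∧ (∃ d : ℝ, d ≠ 0 ∧ b.2 = d • a.2))) ∧
    (∀ x y : Fin 3 → ℝ, x ≠ 0 → y ≠ 0 →
      (pform t x y = 0 ↔
        ∃ uv ∈ Zlist t, (∃ c : ℝ, c ≠ 0 ∧ x = c • uv.1) ∧ (∃ d : ℝ, d ≠ 0 ∧ y = d • uv.2))) ∧
    (∃ q : MvPolynomial (Fin 3 ⊕ Fin 3) ℝ, IsBiquadratic q ∧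
      (∀ x y : Fin 3 → ℝ, 0 ≤ eval (Sum.elim x y) q) ∧
      Set.ncard {z : Projectivization ℝ (Fin 3 → ℝ) × Projectivization ℝ (Fin 3 → ℝ) |
        eval (Sum.elim z.1.rep z.2.rep) q = 0} = 10) := by
  simp only [Set.mem_insert_iff, Set.mem_singleton_iff, not_or] at ht
  obtain ⟨hm, ht0, h1⟩ := ht
  have ht' : t ^ 2 ≠ 1 := sq_ne_one_iff.2 ⟨h1, hm⟩
  refine ⟨Zlist_pairwise ht0, fun x y hx hy => pform_eq_zero_iff ht0 ht' hx hy, pformPoly t,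
    isBiquadratic_pformPoly t, fun x y => ?_, ?_⟩
  · rw [eval_pformPoly]
    exact pform_nonneg ht0 x y
  · classical
    have : {z : Projectivization ℝ (Fin 3 → ℝ) × Projectivization ℝ (Fin 3 → ℝ) |
        eval (Sum.elim z.1.rep z.2.rep) (pformPoly t) = 0} = ((projZlist t).toFinset : Set _) := by
      ext z
      simp [eval_pformPoly, mem_projZlist_iff ht0 ht']
    rw [this, Set.ncard_coe_finset, List.toFinset_card_of_nodup (projZlist_nodup ht0)]
    simp [projZlist, Zlist]
end

section
/- Let t ∈ ℝ with t ∉ {−1,0,1}. If q is a real biquadratic form in x = (x₁,x₂,x₃) and y = (y₁,y₂,y₃) such that q and all six of its first-order partial derivatives ∂q/∂x₁, ∂q/∂x₂, ∂q/∂x₃, ∂q/∂y₁, ∂q/∂y₂, ∂q/∂y₃ vanish at each of the ten points (u,v) ∈ Z_t = {((1,1,1),(1,1,1)), ((1,1,−1),(1,1,−1)), ((1,−1,1),(1,−1,1)), ((−1,1,1),(−1,1,1)), ((1,t,0),(t,1,0)), ((1,−t,0),(−t,1,0)), ((0,1,t),(0,t,1)), ((0,1,−t),(0,−t,1)), ((t,0,1),(1,0,t)),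 ((−t,0,1),(1,0,−t))}, then q = λ·p_t for some real number λ. -/
open MvPolynomial

/-- The biquadratic form `p_t` as a polynomial in the six variables
`x₁ = X (.inl 0), x₂ = X (.inl 1), x₃ = X (.inl 2), y₁ = X (.inr 0), y₂ = X (.inr 1),
y₃ = X (.inr 2)`. -/
noncomputable def Pt (t : ℝ) : MvPolynomial (Fin 3 ⊕ Fin 3) ℝ :=
  (C ((t^2-1)^2) * X (Sum.inl 0)^2 + X (Sum.inl 1)^2 + C (t^4) * X (Sum.inl 2)^2)
      * X (Sum.inr 0)^2 +
  (C ((t^2-1)^2) * X (Sum.inl 1)^2 + X (Sum.inl 2)^2 + C (t^4) * X (Sum.inl 0)^2)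
      * X (Sum.inr 1)^2 +
  (C ((t^2-1)^2) * X (Sum.inl 2)^2 + X (Sum.inl 0)^2 + C (t^4) * X (Sum.inl 1)^2)
      * X (Sum.inr 2)^2 -
  C (2*(t^4-t^2+1)) *
    (X (Sum.inl 0) * X (Sum.inl 1) * X (Sum.inr 0) * X (Sum.inr 1) +
     X (Sum.inl 0) * X (Sum.inl 2) * X (Sum.inr 0) * X (Sum.inr 2) +
     X (Sum.inl 1) * X (Sum.inl 2) * X (Sum.inr 1) * X (Sum.inr 2))

/-- The coefficient tensor `∂⁴q / ∂xᵢ∂xⱼ∂yₖ∂yₗ` of a biquadratic form. -/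
noncomputable def coeffTensor (q : MvPolynomial (Fin 3 ⊕ Fin 3) ℝ) (i j k l : Fin 3) : ℝ :=
  coeff 0 (pderiv (.inr l) (pderiv (.inr k) (pderiv (.inl j) (pderiv (.inl i) q))))

theorem MvPolynomial.pderiv_pderiv_comm {R σ : Type*} [CommRing R] (i j : σ)
    (p : MvPolynomial σ R) : pderiv i (pderiv j p) = pderiv j (pderiv i p) := by
  classical
  have h : ⁅pderiv (R := R) i, pderiv (R := R) j⁆ = 0 := by
    refine MvPolynomial.derivation_ext fun k => ?_
    simp [Derivation.commutator_apply, pderiv_X, Pi.single_apply, apply_ite]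
  have h' := congrArg (fun D : Derivation R _ _ => D p) h
  simpa [Derivation.commutator_apply, sub_eq_zero] using h'

/-- The weights that compute the degree in the `x`-variables. -/
abbrev xWeight : Fin 3 ⊕ Fin 3 → ℕ := Sum.elim (fun _ => 1) (fun _ => 0)

/-- The weights that compute the degree in the `y`-variables. -/
abbrev yWeight : Fin 3 ⊕ Fin 3 → ℕ := Sum.elim (fun _ => 0) (fun _ => 1)

theorem sum_X_inl_mul_pderiv {q : MvPolynomial (Fin 3 ⊕ Fin 3) ℝ} {n : ℕ}
    (h : q.IsWeightedHomogeneous xWeight n) :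
    ∑ i, X (.inl i) * pderiv (.inl i) q = n • q := by
  simpa using h.sum_weight_X_mul_pderiv

theorem sum_X_inr_mul_pderiv {q : MvPolynomial (Fin 3 ⊕ Fin 3) ℝ} {n : ℕ}
    (h : q.IsWeightedHomogeneous yWeight n) :
    ∑ i, X (.inr i) * pderiv (.inr i) q = n • q := by
  simpa using h.sum_weight_X_mul_pderiv

theorem eq_C_of_isWeightedHomogeneous_zero {q : MvPolynomial (Fin 3 ⊕ Fin 3) ℝ}
    (hx : q.IsWeightedHomogeneous xWeight 0) (hy : q.IsWeightedHomogeneous yWeight 0) :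
    q = C (coeff 0 q) := by
  classical
  ext d
  rw [coeff_C]
  split_ifs with hd
  · rw [hd]
  · by_contra hne
    have h1 := hx hne
    have h2 := hy hne
    apply hd
    rw [Finsupp.weight_apply, Finsupp.sum_fintype _ _ (by simp)] at h1 h2
    ext (i | i) <;> simp_all

theorem IsBiquadratic.pderiv_eq_C {q : MvPolynomial (Fin 3 ⊕ Fin 3) ℝ} (hq : IsBiquadratic q)
    (i j k l : Fin 3) :
    pderiv (.inr l) (pderiv (.inr k) (pderiv (.inl j) (pderiv (.inl i) q))) =
      C (coeffTensor q i j k l) :=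
  eq_C_of_isWeightedHomogeneous_zero
    ((((hq.1.pderiv (n' := 1) rfl).pderiv (n' := 0) rfl).pderiv (n' := 0) rfl).pderiv rfl)
    ((((hq.2.pderiv (n' := 2) rfl).pderiv (n' := 2) rfl).pderiv (n' := 1) rfl).pderiv rfl)

theorem IsBiquadratic.two_mul_pderiv_inl {q : MvPolynomial (Fin 3 ⊕ Fin 3) ℝ}
    (hq : IsBiquadratic q) (i : Fin 3) :
    2 * pderiv (.inl i) q = ∑ j, ∑ k, ∑ l,
      C (coeffTensor q i j k l) * X (.inl j) * X (.inr k) * X (.inr l) := by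
  have hx : (pderiv (.inl i) q).IsWeightedHomogeneous xWeight 1 := hq.1.pderiv rfl
  have hy : (pderiv (.inl i) q).IsWeightedHomogeneous yWeight 2 := hq.2.pderiv rfl
  rw [← one_smul ℕ (pderiv (.inl i) q), ← sum_X_inl_mul_pderiv hx, Finset.mul_sum]
  refine Finset.sum_congr rfl fun j _ => ?_
  have hj : (pderiv (.inl j) (pderiv (.inl i) q)).IsWeightedHomogeneous yWeight 2 :=
    hy.pderiv rfl
  have e := sum_X_inr_mul_pderiv hj
  rw [two_nsmul, ← two_mul] at e
  rw [mul_left_comm, ← e, Finset.mul_sum]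
  refine Finset.sum_congr rfl fun k _ => ?_
  have hk : (pderiv (.inr k) (pderiv (.inl j) (pderiv (.inl i) q))).IsWeightedHomogeneous
      yWeight 1 := hj.pderiv rfl
  rw [← one_smul ℕ (pderiv (.inr k) (pderiv (.inl j) (pderiv (.inl i) q))),
    ← sum_X_inr_mul_pderiv hk, Finset.mul_sum, Finset.mul_sum]
  refine Finset.sum_congr rfl fun l _ => ?_
  rw [hq.pderiv_eq_C]
  ring

theorem IsBiquadratic.two_mul_pderiv_inr {q : MvPolynomial (Fin 3 ⊕ Fin 3) ℝ}
    (hq : IsBiquadratic q) (k : Fin 3) :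
    2 * pderiv (.inr k) q = ∑ i, ∑ j, ∑ l,
      C (coeffTensor q i j k l) * X (.inl i) * X (.inl j) * X (.inr l) := by
  have hx : (pderiv (.inr k) q).IsWeightedHomogeneous xWeight 2 := hq.1.pderiv rfl
  have e := sum_X_inl_mul_pderiv hx
  rw [two_nsmul, ← two_mul] at e
  rw [← e]
  refine Finset.sum_congr rfl fun i _ => ?_
  have hi : (pderiv (.inl i) (pderiv (.inr k) q)).IsWeightedHomogeneous xWeight 1 :=
    hx.pderiv rfl
  rw [← one_smul ℕ (pderiv (.inl i) (pderiv (.inr k) q)),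
    ← sum_X_inl_mul_pderiv hi, Finset.mul_sum]
  refine Finset.sum_congr rfl fun j _ => ?_
  have hj : (pderiv (.inl j) (pderiv (.inl i) (pderiv (.inr k) q))).IsWeightedHomogeneous
      yWeight 1 :=
    ((hq.2.pderiv (n' := 1) rfl).pderiv (n' := 1) rfl).pderiv rfl
  rw [← one_smul ℕ (pderiv (.inl j) (pderiv (.inl i) (pderiv (.inr k) q))),
    ← sum_X_inr_mul_pderiv hj, Finset.mul_sum, Finset.mul_sum]
  refine Finset.sum_congr rfl fun l _ => ?_
  rw [pderiv_pderiv_comm (Sum.inl i), pderiv_pderiv_comm (Sum.inl j), hq.pderiv_eq_C]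
  ring

theorem IsBiquadratic.four_mul_eq_sum {q : MvPolynomial (Fin 3 ⊕ Fin 3) ℝ}
    (hq : IsBiquadratic q) :
    4 * q = ∑ i, ∑ j, ∑ k, ∑ l, C (coeffTensor q i j k l) *
      X (.inl i) * X (.inl j) * X (.inr k) * X (.inr l) := by
  have e := sum_X_inl_mul_pderiv hq.1
  rw [two_nsmul, ← two_mul] at e
  rw [show (4 : MvPolynomial (Fin 3 ⊕ Fin 3) ℝ) = 2 * 2 by norm_num, mul_assoc, ← e,
    Finset.mul_sum]
  refine Finset.sum_congr rfl fun i _ => ?_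
  rw [mul_left_comm, hq.two_mul_pderiv_inl]
  simp only [Finset.mul_sum]
  refine Finset.sum_congr rfl fun j _ => Finset.sum_congr rfl fun k _ =>
    Finset.sum_congr rfl fun l _ => ?_
  ring

/-- A 4-tensor with the index symmetries of a biquadratic form, the gradient of which vanishes
at each of the ten points of `Z_t`. -/
structure VanishingTensor (t : ℝ) (c : Fin 3 → Fin 3 → Fin 3 → Fin 3 → ℝ) : Prop where
  symm_x : ∀ i j k l, c i j k l = c j i k l
  symm_y : ∀ i j k l, c i j k l = c i j l k
  grad_x : ∀ uv ∈ Zlist t, ∀ i, ∑ j, ∑ k, ∑ l, c i j k l * uv.1 j * uv.2 k * uv.2 l = 0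
  grad_y : ∀ uv ∈ Zlist t, ∀ k, ∑ i, ∑ j, ∑ l, c i j k l * uv.1 i * uv.1 j * uv.2 l = 0

theorem vanishingTensor_coeffTensor {t : ℝ} {q : MvPolynomial (Fin 3 ⊕ Fin 3) ℝ}
    (hq : IsBiquadratic q)
    (hvan : ∀ uv ∈ Zlist t, ∀ i : Fin 3 ⊕ Fin 3, eval (Sum.elim uv.1 uv.2) (pderiv i q) = 0) :
    VanishingTensor t (coeffTensor q) where
  symm_x i j k l := by rw [coeffTensor, pderiv_pderiv_comm (Sum.inl j), coeffTensor]
  symm_y i j k l := by rw [coeffTensor, pderiv_pderiv_comm (Sum.inr l), coeffTensor]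
  grad_x uv h i := by
    have e := congrArg (eval (Sum.elim uv.1 uv.2)) (hq.two_mul_pderiv_inl i)
    simpa only [map_mul, map_sum, eval_C, eval_X, hvan uv h, mul_zero, Sum.elim_inl,
      Sum.elim_inr, eq_comm] using e
  grad_y uv h k := by
    have e := congrArg (eval (Sum.elim uv.1 uv.2)) (hq.two_mul_pderiv_inr k)
    simpa only [map_mul, map_sum, eval_C, eval_X, hvan uv h, mul_zero, Sum.elim_inl,
      Sum.elim_inr, eq_comm] using e

theorem shift_mem_Zlist {t : ℝ} {uv : (Fin 3 → ℝ) × (Fin 3 → ℝ)} (h : uv ∈ Zlist t) :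
    (fun i => uv.1 (i - 1), fun i => uv.2 (i - 1)) ∈ Zlist t := by
  have key (a b c : ℝ) : (fun i => ![a, b, c] (i - 1)) = ![c, a, b] := by
    ext i; fin_cases i <;> rfl
  simp only [Zlist, List.mem_cons, List.not_mem_nil, or_false] at h ⊢
  rcases h with rfl | rfl | rfl | rfl | rfl | rfl | rfl | rfl | rfl | rfl <;> simp [key]

theorem sum_add_one_fin_three (f : Fin 3 → Fin 3 → Fin 3 → ℝ) :
    ∑ i, ∑ j, ∑ k, f i j k = ∑ i, ∑ j, ∑ k, f (i + 1) (j + 1) (k + 1) := by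
  simp only [Fin.sum_univ_three, Fin.reduceAdd, zero_add]
  ring

/-- The cyclic symmetry of the configuration `Z_t`. -/
theorem VanishingTensor.shift {t : ℝ} {c : Fin 3 → Fin 3 → Fin 3 → Fin 3 → ℝ}
    (h : VanishingTensor t c) :
    VanishingTensor t (fun i j k l => c (i + 1) (j + 1) (k + 1) (l + 1)) where
  symm_x _ _ _ _ := h.symm_x _ _ _ _
  symm_y _ _ _ _ := h.symm_y _ _ _ _
  grad_x uv huv i := by
    have e := h.grad_x _ (shift_mem_Zlist huv) (i + 1)
    rw [sum_add_one_fin_three] at e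
    simpa using e
  grad_y uv huv k := by
    have e := h.grad_y _ (shift_mem_Zlist huv) (k + 1)
    rw [sum_add_one_fin_three] at e
    simpa using e


/-- The parts of the gradient equations that involve the monomials of even degree in each pair
`(xᵢ, yᵢ)`, respectively of odd degree in `(x₁, y₁)` and `(x₂, y₂)` only. -/
theorem VanishingTensor.parity_equations {t : ℝ} {c : Fin 3 → Fin 3 → Fin 3 → Fin 3 → ℝ}
    (h : VanishingTensor t c) (h0 : t ≠ 0) :
    (c 0 0 0 0 + c 0 0 1 1 + c 0 0 2 2 + 2 * c 0 1 0 1 + 2 * c 0 2 0 2 = 0 ∧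
      c 0 0 0 0 + c 1 1 0 0 + c 2 2 0 0 + 2 * c 0 1 0 1 + 2 * c 0 2 0 2 = 0 ∧
      c 0 0 0 0 * t ^ 2 + c 0 0 1 1 + 2 * c 0 1 0 1 * t ^ 2 = 0 ∧
      c 1 1 0 0 * t ^ 2 + c 1 1 1 1 + 2 * c 0 1 0 1 = 0 ∧
      c 0 0 0 0 + c 1 1 0 0 * t ^ 2 + 2 * c 0 1 0 1 = 0) ∧
    (c 2 2 0 1 + c 0 2 1 2 + c 1 2 0 2 = 0 ∧
      c 0 1 2 2 + c 0 2 1 2 + c 1 2 0 2 = 0 ∧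
      c 0 1 0 0 * t ^ 2 + c 0 1 1 1 + 2 * c 0 0 0 1 = 0 ∧
      c 0 1 0 0 * t ^ 2 + c 0 1 1 1 + 2 * c 1 1 0 1 * t ^ 2 = 0 ∧
      2 * c 0 1 0 0 * t ^ 2 + c 0 0 0 1 + c 1 1 0 1 * t ^ 2 = 0 ∧
      2 * c 0 1 1 1 + c 0 0 0 1 + c 1 1 0 1 * t ^ 2 = 0 ∧
      c 0 1 1 1 * t ^ 2 + c 0 1 2 2 + 2 * c 0 2 1 2 * t ^ 2 = 0 ∧
      c 1 1 0 1 + c 2 2 0 1 * t ^ 2 + 2 * c 1 2 0 2 = 0 ∧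
      c 0 1 0 0 + c 0 1 2 2 * t ^ 2 + 2 * c 1 2 0 2 = 0 ∧
      c 0 0 0 1 * t ^ 2 + c 2 2 0 1 + 2 * c 0 2 1 2 * t ^ 2 = 0) := by
  have gx := h.grad_x
  have gy := h.grad_y
  simp only [Zlist, List.forall_mem_cons, List.not_mem_nil, implies_true, and_true,
    Fin.forall_fin_succ, IsEmpty.forall_iff, Fin.sum_univ_three, h.symm_x 1 0, h.symm_x 2 0,
    h.symm_x 2 1, h.symm_y _ _ 1 0, h.symm_y _ _ 2 0, h.symm_y _ _ 2 1, Fin.succ_zero_eq_one,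
    Fin.succ_one_eq_two, Matrix.cons_val] at gx gy
  obtain ⟨⟨xa0, xa1, xa2⟩, ⟨xb0, xb1, xb2⟩, ⟨xc0, xc1, xc2⟩, ⟨xd0, xd1, xd2⟩,
      ⟨xe0, xe1, xe2⟩, ⟨xf0, xf1, xf2⟩, ⟨xg0, xg1, xg2⟩, ⟨xh0, xh1, xh2⟩,
      ⟨xi0, xi1, xi2⟩, ⟨xj0, xj1, xj2⟩⟩ := gx
  obtain ⟨⟨ya0, ya1, ya2⟩, ⟨yb0, yb1, yb2⟩, ⟨yc0, yc1, yc2⟩, ⟨yd0, yd1, yd2⟩,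
      ⟨ye0, ye1, ye2⟩, ⟨yf0, yf1, yf2⟩, ⟨yg0, yg1, yg2⟩, ⟨yh0, yh1, yh2⟩,
      ⟨yi0, yi1, yi2⟩, ⟨yj0, yj1, yj2⟩⟩ := gy
  have cancel {a : ℝ} (ha : t * a = 0) : a = 0 := (mul_eq_zero.mp ha).resolve_left h0
  refine ⟨⟨?_, ?_, ?_, ?_, ?_⟩, ?_, ?_, ?_, ?_, ?_, ?_, ?_, ?_, ?_, ?_⟩
  · linarith only [xa0, xb0, xc0, xd0]
  · linarith only [ya0, yb0, yc0, yd0]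
  · linarith only [xe0, xf0]
  · exact cancel (by linarith only [xe1, xf1])
  · exact cancel (by linarith only [ye0, yf0])
  · linarith only [xa2, xb2, xc2, xd2]
  · linarith only [ya2, yb2, yc2, yd2]
  · exact cancel (by linarith only [xe0, xf0])
  · linarith only [xe1, xf1]
  · linarith only [ye0, yf0]
  · exact cancel (by linarith only [ye1, yf1])
  · linarith only [xg0, xh0]
  · exact cancel (by linarith only [yg0, yh0])
  · exact cancel (by linarith only [xi1, xj1])
  · linarith only [yi1, yj1]

theorem VanishingTensor.mixed_eq_zero {t : ℝ} {c : Fin 3 → Fin 3 → Fin 3 → Fin 3 → ℝ}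
    (h : VanishingTensor t c) (h0 : t ≠ 0) (h1 : t ^ 2 - 1 ≠ 0) :
    c 0 1 0 0 = 0 ∧ c 0 1 1 1 = 0 ∧ c 0 1 2 2 = 0 ∧ c 0 0 0 1 = 0 ∧ c 1 1 0 1 = 0 ∧
      c 2 2 0 1 = 0 ∧ c 0 2 1 2 = 0 ∧ c 1 2 0 2 = 0 := by
  obtain ⟨-, e1, e2, e3, e4, e5, e6, e7, e8, e9, -⟩ := h.parity_equations h0
  have hr1 : c 0 0 0 1 = c 1 1 0 1 * t ^ 2 := by linear_combination (e3 - e4) / 2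
  have hp1 : c 0 1 0 0 = -c 1 1 0 1 :=
    mul_left_cancel₀ (pow_ne_zero 2 h0) (by linear_combination (e5 - hr1) / 2)
  have hr2 : c 1 1 0 1 = 0 := by linear_combination (e8 - e9 + hp1 + t ^ 2 * (e2 - e1)) / 2
  have hr1' : c 0 0 0 1 = 0 := by simp [hr1, hr2]
  have hp1' : c 0 1 0 0 = 0 := by simp [hp1, hr2]
  have hp2 : c 0 1 1 1 = 0 := by linear_combination (e6 - hr1' - t ^ 2 * hr2) / 2
  have hp3 : c 0 1 2 2 = -2 * c 0 2 1 2 * t ^ 2 := by linear_combination e7 - t ^ 2 * hp2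
  have hw : c 1 2 0 2 = c 0 2 1 2 * t ^ 4 := by
    linear_combination (e9 - hp1' - t ^ 2 * hp3) / 2
  have hs : c 0 2 1 2 = 0 :=
    mul_left_cancel₀ (pow_ne_zero 2 h1) (by linear_combination e2 - hp3 - hw)
  refine ⟨hp1', hp2, by simp [hp3, hs], hr1', hr2, ?_, hs, by simp [hw, hs]⟩
  linear_combination e1 - hs - hw - t ^ 4 * hs

theorem VanishingTensor.even_relations {t : ℝ} {c : Fin 3 → Fin 3 → Fin 3 → Fin 3 → ℝ}
    (h : VanishingTensor t c) (h0 : t ≠ 0) (h1 : t ^ 2 - 1 ≠ 0) :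
    c 0 0 0 0 = (t ^ 2 - 1) ^ 2 * c 1 1 0 0 ∧ c 0 0 1 1 = t ^ 4 * c 1 1 0 0 ∧
      c 0 0 2 2 = c 1 1 0 0 ∧ 2 * c 0 1 0 1 = -(t ^ 4 - t ^ 2 + 1) * c 1 1 0 0 := by
  obtain ⟨⟨e1, e2, e3, e4, e5⟩, -⟩ := h.parity_equations h0
  obtain ⟨⟨-, -, f3, f4, f5⟩, -⟩ := h.shift.shift.parity_equations h0
  simp only [Fin.isValue, Fin.reduceAdd, zero_add, h.symm_x 2 0, h.symm_y _ _ 2 0] at f3 f4 f5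
  have hne : (t ^ 2 - 1) * (t ^ 2 + 1) ≠ 0 := mul_ne_zero h1 (by positivity)
  have hw : c 0 0 2 2 = c 1 1 0 0 := mul_left_cancel₀ hne (by
    linear_combination e2 - e1 + e3 - t ^ 2 * e5 - f3 + t ^ 2 * f5)
  have hα : c 0 0 0 0 = (t ^ 2 - 1) ^ 2 * c 1 1 0 0 := by
    linear_combination -e1 + e5 + f4 + (e3 - t ^ 2 * e5) + (1 - t ^ 2) * hw
  exact ⟨hα, by linear_combination e3 - t ^ 2 * e5, hw, by linear_combination e5 - hα⟩

/-- For `t ∉ {-1, 0, 1}`, any biquadratic form vanishing to second order (i.e. together with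
all six first-order partial derivatives) at each of the ten points of `Z_t` is a scalar
multiple of `p_t`. -/
theorem biquadratic_vanishing_scalar_multiple (t : ℝ) (ht : t ∉ ({-1, 0, 1} : Set ℝ))
    (q : MvPolynomial (Fin 3 ⊕ Fin 3) ℝ) (hq : IsBiquadratic q)
    (hvan : ∀ uv ∈ Zlist t, eval (Sum.elim uv.1 uv.2) q = 0 ∧
      ∀ i : Fin 3 ⊕ Fin 3, eval (Sum.elim uv.1 uv.2) (pderiv i q) = 0) :
    ∃ l : ℝ, q = l • Pt t := by
  obtain ⟨h0, h1⟩ : t ≠ 0 ∧ t ^ 2 - 1 ≠ 0 := by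
    simp only [Set.mem_insert_iff, Set.mem_singleton_iff, not_or] at ht
    exact ⟨ht.2.1, fun h =>
      (sq_eq_sq_iff_eq_or_eq_neg.mp ((sub_eq_zero.mp h).trans (one_pow 2).symm)).elim ht.2.2 ht.1⟩
  have h := vanishingTensor_coeffTensor hq fun uv huv => (hvan uv huv).2
  have hsum := hq.four_mul_eq_sum
  generalize coeffTensor q = c at h hsum
  have sx : (∀ k l, c 1 0 k l = c 0 1 k l) ∧ (∀ k l, c 2 0 k l = c 0 2 k l) ∧
      ∀ k l, c 2 1 k l = c 1 2 k l := ⟨h.symm_x 1 0, h.symm_x 2 0, h.symm_x 2 1⟩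
  have sy : (∀ i j, c i j 1 0 = c i j 0 1) ∧ (∀ i j, c i j 2 0 = c i j 0 2) ∧
      ∀ i j, c i j 2 1 = c i j 1 2 :=
    ⟨(h.symm_y · · 1 0), (h.symm_y · · 2 0), (h.symm_y · · 2 1)⟩
  have m0 := h.mixed_eq_zero h0 h1
  have m1 := h.shift.mixed_eq_zero h0 h1
  have m2 := h.shift.shift.mixed_eq_zero h0 h1
  obtain ⟨a0, b0, d0, g0⟩ := h.even_relations h0 h1
  obtain ⟨a1, b1, d1, g1⟩ := h.shift.even_relations h0 h1
  obtain ⟨a2, b2, d2, g2⟩ := h.shift.shift.even_relations h0 h1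
  simp only [Fin.isValue, Fin.reduceAdd, zero_add, sx, sy] at m1 m2 a1 b1 d1 g1 a2 b2 d2 g2
  obtain ⟨l, hl⟩ : ∃ l, c 1 1 0 0 = 4 * l := ⟨c 1 1 0 0 / 4, by ring⟩
  have e0 : c 0 1 0 1 = -2 * (t ^ 4 - t ^ 2 + 1) * l := by
    linear_combination (g0 - (t ^ 4 - t ^ 2 + 1) * hl) / 2
  have e1 : c 1 2 1 2 = -2 * (t ^ 4 - t ^ 2 + 1) * l := by
    linear_combination (g1 - (t ^ 4 - t ^ 2 + 1) * (hl - d1)) / 2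
  have e2 : c 0 2 0 2 = -2 * (t ^ 4 - t ^ 2 + 1) * l := by
    linear_combination (g2 - (t ^ 4 - t ^ 2 + 1) * (hl + d0)) / 2
  have four_ne : (4 : MvPolynomial (Fin 3 ⊕ Fin 3) ℝ) ≠ 0 := by
    rw [← map_ofNat C 4]
    exact C_ne_zero.mpr four_ne_zero
  refine ⟨l, mul_left_cancel₀ four_ne ?_⟩
  rw [hsum, smul_eq_C_mul, Pt]
  simp only [Fin.sum_univ_three, sx, sy, m0, m1, m2, a0, a1, a2, b0, b1, b2, e0, e1, e2, d0, ← d1,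
    hl, map_mul, map_add, map_sub, map_neg, map_pow, map_one, map_zero, map_ofNat]
  ring
end

section
/- Let t ∈ ℝ with t ∉ {−1,0,1}. The form p_t is extremal in the convex cone of nonnegative biquadratic forms: if q and r are biquadratic forms in x = (x₁,x₂,x₃) and y = (y₁,y₂,y₃) with q(x,y) ≥ 0 and r(x,y) ≥ 0 for all x, y ∈ ℝ³ and p_t = q + r, then there exist real numbers λ, μ ≥ 0 with q = λ·p_t and r = μ·p_t. -/
open MvPolynomial

/-- The biquadratic form function with coefficient tensor `c`. -/
def tensorForm (c : Fin 3 → Fin 3 → Fin 3 → Fin 3 → ℝ) (x y : Fin 3 → ℝ) : ℝ :=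
  ∑ i, ∑ j, ∑ k, ∑ l, c i j k l * (x i * x j * (y k * y l))

/-- Symmetry of a coefficient tensor in its `x`-indices and in its `y`-indices. -/
def IsPairSymm (c : Fin 3 → Fin 3 → Fin 3 → Fin 3 → ℝ) : Prop :=
  (∀ i j k l, c i j k l = c j i k l) ∧ ∀ i j k l, c i j k l = c i j l k

/-- The form `p_t` as a real function. -/
def ptFun (t : ℝ) (x y : Fin 3 → ℝ) : ℝ :=
  ((t^2-1)^2 * x 0^2 + x 1^2 + t^4 * x 2^2) * y 0^2 +
  ((t^2-1)^2 * x 1^2 + x 2^2 + t^4 * x 0^2) * y 1^2 +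
  ((t^2-1)^2 * x 2^2 + x 0^2 + t^4 * x 1^2) * y 2^2 -
  2*(t^4-t^2+1) * (x 0 * x 1 * y 0 * y 1 + x 0 * x 2 * y 0 * y 2 + x 1 * x 2 * y 1 * y 2)

lemma eval_Pt (t : ℝ) (x y : Fin 3 → ℝ) : eval (Sum.elim x y) (Pt t) = ptFun t x y := by
  simp [Pt, ptFun]

/-- A monomial of degree `2` in three variables is a product of two variables. -/
lemma exists_prod_pow_eq_mul {d : Fin 3 →₀ ℕ} (h : d 0 + d 1 + d 2 = 2) :
    ∃ a b : Fin 3, ∀ x : Fin 3 → ℝ, ∏ i, x i ^ d i = x a * x b := by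
  simp only [Fin.prod_univ_three]
  generalize d 0 = p at *
  generalize d 1 = q at *
  generalize d 2 = r at *
  have : (p = 2 ∧ q = 0 ∧ r = 0) ∨ (p = 0 ∧ q = 2 ∧ r = 0) ∨ (p = 0 ∧ q = 0 ∧ r = 2) ∨
    (p = 1 ∧ q = 1 ∧ r = 0) ∨ (p = 1 ∧ q = 0 ∧ r = 1) ∨ (p = 0 ∧ q = 1 ∧ r = 1) := by omega
  rcases this with ⟨rfl, rfl, rfl⟩ | ⟨rfl, rfl, rfl⟩ | ⟨rfl, rfl, rfl⟩ | ⟨rfl, rfl, rfl⟩ |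
    ⟨rfl, rfl, rfl⟩ | ⟨rfl, rfl, rfl⟩
  exacts [⟨0, 0, fun x => by ring⟩, ⟨1, 1, fun x => by ring⟩, ⟨2, 2, fun x => by ring⟩,
    ⟨0, 1, fun x => by ring⟩, ⟨0, 2, fun x => by ring⟩, ⟨1, 2, fun x => by ring⟩]

lemma exists_tensor_smul_product (r : ℝ) (a b e f : Fin 3) :
    ∃ c, IsPairSymm c ∧ ∀ x y, tensorForm c x y = r * (x a * x b * (y e * y f)) := by
  refine ⟨fun i j k l => r / 4 *
    (((if i = a then 1 else 0) * (if j = b then 1 else 0) +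
      (if j = a then 1 else 0) * (if i = b then 1 else 0)) *
     ((if k = e then 1 else 0) * (if l = f then 1 else 0) +
      (if l = e then 1 else 0) * (if k = f then 1 else 0))),
    ⟨fun i j k l => by ring, fun i j k l => by ring⟩, fun x y => ?_⟩
  have key : ∀ (u : Fin 3 → ℝ) (m n : Fin 3), ∑ i, ∑ j,
      (((if i = m then 1 else 0) * (if j = n then 1 else 0) +
      (if j = m then 1 else 0) * (if i = n then 1 else 0)) * (u i * u j)) = 2 * (u m * u n) := by
    intro u m n
    simp [add_mul, Finset.sum_add_distrib]
    ring
  calc _ = r / 4 * ((∑ i, ∑ j,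
      (((if i = a then 1 else 0) * (if j = b then 1 else 0) +
      (if j = a then 1 else 0) * (if i = b then 1 else 0)) * (x i * x j))) * ∑ k, ∑ l,
      (((if k = e then 1 else 0) * (if l = f then 1 else 0) +
      (if l = e then 1 else 0) * (if k = f then 1 else 0)) * (y k * y l))) := by
        simp only [tensorForm, Finset.sum_mul]
        simp only [Finset.mul_sum]
        refine Finset.sum_congr rfl fun i _ => Finset.sum_congr rfl fun j _ =>
          Finset.sum_congr rfl fun k _ => Finset.sum_congr rfl fun l _ => by ring
    _ = _ := by rw [key, key]; ring

lemma IsBiquadratic.exists_tensor {q : MvPolynomial (Fin 3 ⊕ Fin 3) ℝ} (hq : IsBiquadratic q) :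
    ∃ c, IsPairSymm c ∧ ∀ x y, eval (Sum.elim x y) q = tensorForm c x y := by
  have hmon : ∀ d : Fin 3 ⊕ Fin 3 →₀ ℕ, ∃ c, IsPairSymm c ∧
      ∀ x y, eval (Sum.elim x y) (monomial d (coeff d q)) = tensorForm c x y := by
    intro d
    by_cases hd : coeff d q = 0
    · exact ⟨0, ⟨fun _ _ _ _ => rfl, fun _ _ _ _ => rfl⟩, fun x y => by simp [hd, tensorForm]⟩
    have h1 := hq.1 hd
    have h2 := hq.2 hd
    rw [Finsupp.weight_apply, Finsupp.sum_fintype _ _ (by simp)] at h1 h2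
    simp [Fin.sum_univ_three] at h1 h2
    obtain ⟨a, b, hab⟩ := exists_prod_pow_eq_mul (d := d.comapDomain Sum.inl
      Sum.inl_injective.injOn) (by simpa using h1)
    obtain ⟨e, f, hef⟩ := exists_prod_pow_eq_mul (d := d.comapDomain Sum.inr
      Sum.inr_injective.injOn) (by simpa using h2)
    obtain ⟨c, hc, hcx⟩ := exists_tensor_smul_product (coeff d q) a b e f
    refine ⟨c, hc, fun x y => ?_⟩
    rw [hcx, ← hab, ← hef, eval_monomial, Finsupp.prod_fintype _ _ (by simp)]
    simp
  choose c hc hcq using hmon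
  refine ⟨fun i j k l => ∑ d ∈ q.support, c d i j k l,
    ⟨fun i j k l => Finset.sum_congr rfl fun d _ => (hc d).1 i j k l,
      fun i j k l => Finset.sum_congr rfl fun d _ => (hc d).2 i j k l⟩, fun x y => ?_⟩
  conv_lhs => rw [q.as_sum]
  rw [map_sum, Finset.sum_congr rfl fun d _ => hcq d x y]
  simp only [tensorForm, Fin.sum_univ_three, Finset.sum_mul, Finset.sum_add_distrib]

lemma eq_zero_of_forall_nonneg_quadratic {a b : ℝ} (h : ∀ s : ℝ, 0 ≤ 2 * s * a + s ^ 2 * b) :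
    a = 0 := by
  have := discrim_le_zero (a := b) (b := 2 * a) (c := 0) fun s => by linarith [h s]
  simp only [discrim] at this
  nlinarith [sq_nonneg a]

section

variable {c : Fin 3 → Fin 3 → Fin 3 → Fin 3 → ℝ} {t : ℝ}

lemma tensorForm_grad_left (hc : IsPairSymm c) (h0 : ∀ x y, 0 ≤ tensorForm c x y)
    {x y : Fin 3 → ℝ} (hxy : tensorForm c x y ≤ 0) (u : Fin 3 → ℝ) :
    ∑ i, ∑ j, ∑ k, ∑ l, c i j k l * (x i * u j * (y k * y l)) = 0 := by
  refine eq_zero_of_forall_nonneg_quadratic (b := tensorForm c u y) fun s => ?_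
  have hexp : tensorForm c (fun i => x i + s * u i) y = tensorForm c x y +
      2 * s * (∑ i, ∑ j, ∑ k, ∑ l, c i j k l * (x i * u j * (y k * y l))) +
      s ^ 2 * tensorForm c u y := by
    simp only [tensorForm, Fin.sum_univ_three]
    simp only [hc.1 1 0, hc.1 2 0, hc.1 2 1]
    ring
  linarith [h0 (fun i => x i + s * u i) y]

lemma tensorForm_swap (x y : Fin 3 → ℝ) :
    tensorForm (fun i j k l => c k l i j) y x = tensorForm c x y := by
  simp only [tensorForm, Fin.sum_univ_three]
  ring

lemma tensorForm_grad_right (hc : IsPairSymm c) (h0 : ∀ x y, 0 ≤ tensorForm c x y)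
    {x y : Fin 3 → ℝ} (hxy : tensorForm c x y ≤ 0) (u : Fin 3 → ℝ) :
    ∑ k, ∑ l, ∑ i, ∑ j, c i j k l * (y k * u l * (x i * x j)) = 0 :=
  tensorForm_grad_left (c := fun i j k l => c k l i j)
    ⟨fun i j k l => hc.2 k l i j, fun i j k l => hc.1 k l i j⟩
    (fun x y => by rw [tensorForm_swap]; exact h0 y x) (by rwa [tensorForm_swap]) u

/-- The symmetric tensor `c` defines a form lying between `0` and `p_t`. -/
structure IsBetween (t : ℝ) (c : Fin 3 → Fin 3 → Fin 3 → Fin 3 → ℝ) : Prop where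
  symm : IsPairSymm c
  nonneg : ∀ x y, 0 ≤ tensorForm c x y
  le_ptFun : ∀ x y, tensorForm c x y ≤ ptFun t x y

namespace IsBetween

lemma rotate (h : IsBetween t c) :
    IsBetween t fun i j k l => c (i + 1) (j + 1) (k + 1) (l + 1) := by
  have key : ∀ x y, tensorForm (fun i j k l => c (i + 1) (j + 1) (k + 1) (l + 1)) x y =
      tensorForm c ![x 2, x 0, x 1] ![y 2, y 0, y 1] := by
    intro x y
    simp [tensorForm, Fin.sum_univ_three]
    ring
  refine ⟨⟨fun _ _ _ _ => h.symm.1 .., fun _ _ _ _ => h.symm.2 ..⟩,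
    fun x y => key x y ▸ h.nonneg .., fun x y => key x y ▸ (h.le_ptFun ..).trans_eq ?_⟩
  simp [ptFun]
  ring

lemma grad_left (h : IsBetween t c) {x y : Fin 3 → ℝ} (hxy : ptFun t x y = 0) (m : Fin 3) :
    ∑ i, ∑ k, ∑ l, c i m k l * (x i * (y k * y l)) = 0 := by
  simpa [Pi.single_apply] using
    tensorForm_grad_left h.symm h.nonneg ((h.le_ptFun x y).trans_eq hxy) (Pi.single m 1)

lemma grad_right (h : IsBetween t c) {x y : Fin 3 → ℝ} (hxy : ptFun t x y = 0) (m : Fin 3) :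
    ∑ k, ∑ i, ∑ j, c i j k m * (y k * (x i * x j)) = 0 := by
  simpa [Pi.single_apply] using
    tensorForm_grad_right h.symm h.nonneg ((h.le_ptFun x y).trans_eq hxy) (Pi.single m 1)

end IsBetween

lemma ptFun_edge (t e : ℝ) (he : e ^ 2 = 1) : ptFun t ![1, e * t, 0] ![t, e, 0] = 0 := by
  simp [ptFun]
  linear_combination
    (t^2 * (t^2-1)^2 * e^2 + t^2 * (t^2-1)^2 + t^4 + t^4 - 2 * (t^4-t^2+1) * t^2) * he

lemma ptFun_signs (t e f : ℝ) (he : e = 1 ∨ e = -1) (hf : f = 1 ∨ f = -1) :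
    ptFun t ![1, e, f] ![1, e, f] = 0 := by
  rcases he with rfl | rfl <;> rcases hf with rfl | rfl <;> simp [ptFun] <;> ring

namespace IsBetween

/-- The even and odd parts, in the sign `e`, of the gradient at the zero
`((1, e * t, 0), (t, e, 0))`. -/
lemma edge_left (h : IsBetween t c) (ht : t ≠ 0) (m : Fin 3) :
    c 0 m 0 0 * t ^ 2 + c 0 m 1 1 + 2 * t ^ 2 * c 1 m 0 1 = 0 ∧
      2 * c 0 m 0 1 + t ^ 2 * c 1 m 0 0 + c 1 m 1 1 = 0 := by
  have h1 := h.grad_left (ptFun_edge t 1 (by norm_num)) m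
  have h2 := h.grad_left (ptFun_edge t (-1) (by norm_num)) m
  simp [Fin.sum_univ_three, h.symm.2 _ _ 1 0] at h1 h2
  exact ⟨by linear_combination (h1 + h2) / 2,
    mul_left_cancel₀ ht (by linear_combination (h1 - h2) / 2)⟩

lemma edge_right (h : IsBetween t c) (ht : t ≠ 0) (m : Fin 3) :
    c 0 0 0 m + t ^ 2 * c 1 1 0 m + 2 * c 0 1 1 m = 0 ∧
      2 * t ^ 2 * c 0 1 0 m + c 0 0 1 m + t ^ 2 * c 1 1 1 m = 0 := by
  have h1 := h.grad_right (ptFun_edge t 1 (by norm_num)) m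
  have h2 := h.grad_right (ptFun_edge t (-1) (by norm_num)) m
  simp [Fin.sum_univ_three, h.symm.1 1 0] at h1 h2
  exact ⟨mul_left_cancel₀ ht (by linear_combination (h1 + h2) / 2),
    by linear_combination (h1 - h2) / 2⟩

lemma signs_left (h : IsBetween t c) :
    c 0 0 0 0 + c 0 0 1 1 + c 0 0 2 2 + 2 * c 0 1 0 1 + 2 * c 0 2 0 2 = 0 ∧
      c 0 1 0 0 + c 0 1 1 1 + c 0 1 2 2 + 2 * c 0 0 0 1 + 2 * c 0 2 1 2 = 0 := by
  have h1 := h.grad_left (ptFun_signs t 1 1 (by simp) (by simp)) 0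
  have h2 := h.grad_left (ptFun_signs t 1 (-1) (by simp) (by simp)) 0
  have h3 := h.grad_left (ptFun_signs t (-1) 1 (by simp) (by simp)) 0
  have h4 := h.grad_left (ptFun_signs t (-1) (-1) (by simp) (by simp)) 0
  simp [Fin.sum_univ_three, h.symm.2 _ _ 1 0, h.symm.2 _ _ 2 0, h.symm.2 _ _ 2 1,
    h.symm.1 1 0, h.symm.1 2 0] at h1 h2 h3 h4
  constructor <;> linarith

lemma signs_right (h : IsBetween t c) :
    c 0 0 0 0 + c 1 1 0 0 + c 2 2 0 0 + 2 * c 0 1 0 1 + 2 * c 0 2 0 2 = 0 := by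
  have h1 := h.grad_right (ptFun_signs t 1 1 (by simp) (by simp)) 0
  have h2 := h.grad_right (ptFun_signs t 1 (-1) (by simp) (by simp)) 0
  have h3 := h.grad_right (ptFun_signs t (-1) 1 (by simp) (by simp)) 0
  have h4 := h.grad_right (ptFun_signs t (-1) (-1) (by simp) (by simp)) 0
  simp [Fin.sum_univ_three, h.symm.2 _ _ 1 0, h.symm.2 _ _ 2 0,
    h.symm.1 1 0, h.symm.1 2 0, h.symm.1 2 1] at h1 h2 h3 h4
  linarith

/-- The coefficients that are odd in the first two index pairs vanish. -/
lemma mixed_eq_zero (h : IsBetween t c) (ht0 : t ≠ 0) (ht1 : t ^ 2 ≠ 1) :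
    (c 0 1 0 0 = 0 ∧ c 0 1 1 1 = 0 ∧ c 0 1 2 2 = 0 ∧ c 0 2 1 2 = 0) ∧
      c 0 0 0 1 = 0 ∧ c 1 1 0 1 = 0 ∧ c 2 2 0 1 = 0 ∧ c 1 2 0 2 = 0 := by
  have ht2 : t ^ 2 ≠ 0 := pow_ne_zero 2 ht0
  have ht1' : t ^ 2 - 1 ≠ 0 := sub_ne_zero.2 ht1
  have a1 := (h.edge_left ht0 0).2
  have a2 := (h.edge_left ht0 1).1
  have a3 := (h.edge_right ht0 0).2
  have a4 := (h.edge_right ht0 1).1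
  have b1 := (h.rotate.edge_left ht0 2).1
  have b2 := (h.rotate.edge_right ht0 2).1
  have d1 := (h.rotate.rotate.edge_left ht0 2).2
  have d2 := (h.rotate.rotate.edge_right ht0 2).2
  have s := h.signs_left.2
  simp [h.symm.2 _ _ 1 0, h.symm.2 _ _ 2 0, h.symm.2 _ _ 2 1,
    h.symm.1 1 0, h.symm.1 2 0, h.symm.1 2 1] at a1 a2 a3 a4 b1 b2 d1 d2
  have e1 : c 0 1 1 1 = t ^ 2 * c 0 1 0 0 := by linarith
  have e2 : c 1 1 0 1 = - c 0 1 0 0 := mul_left_cancel₀ ht2 (by linarith)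
  have e3 : c 0 0 0 1 = - (t ^ 2 * c 0 1 0 0) := by linarith
  have A : c 0 1 0 0 = 0 := by
    have hp : t ^ 4 + t ^ 2 + 1 ≠ 0 := by positivity
    refine (mul_eq_zero.1 ?_).resolve_left (mul_ne_zero ht1' hp)
    rw [e1] at b1
    rw [e2] at b2
    rw [e3] at d2
    linear_combination (t ^ 2 * b1 - t ^ 2 * d2 - d1 + b2) / 2
  simp only [A, mul_zero, neg_zero] at e1 e2 e3
  simp only [A, e1, e2, e3, mul_zero, zero_add, add_zero] at b1 b2 d1 d2 s
  have hC : c 0 2 1 2 = 0 := (mul_eq_zero.1 (by linarith :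
    (t ^ 2 - 1) * c 0 2 1 2 = 0)).resolve_left ht1'
  rw [hC] at s b1 d2
  have hE : c 0 1 2 2 = 0 := by linarith
  have hF : c 2 2 0 1 = 0 := by linarith
  rw [hE] at d1
  exact ⟨⟨A, e1, hE, hC⟩, e3, e2, hF, by linarith⟩

/-- The coefficients of even monomials agree with those of a multiple of `p_t`. -/
lemma even_coeffs (h : IsBetween t c) (ht0 : t ≠ 0) (ht1 : t ^ 2 ≠ 1) :
    (c 0 0 0 0 = c 1 1 0 0 * (t ^ 2 - 1) ^ 2 ∧ c 1 1 1 1 = c 1 1 0 0 * (t ^ 2 - 1) ^ 2 ∧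
      c 2 2 2 2 = c 1 1 0 0 * (t ^ 2 - 1) ^ 2) ∧
    (c 2 2 1 1 = c 1 1 0 0 ∧ c 0 0 2 2 = c 1 1 0 0) ∧
    (c 0 0 1 1 = c 1 1 0 0 * t ^ 4 ∧ c 1 1 2 2 = c 1 1 0 0 * t ^ 4 ∧
      c 2 2 0 0 = c 1 1 0 0 * t ^ 4) ∧
    2 * c 0 1 0 1 = - (c 1 1 0 0 * (t ^ 4 - t ^ 2 + 1)) ∧
    2 * c 0 2 0 2 = - (c 1 1 0 0 * (t ^ 4 - t ^ 2 + 1)) ∧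
    2 * c 1 2 1 2 = - (c 1 1 0 0 * (t ^ 4 - t ^ 2 + 1)) := by
  have edge : ∀ {b : Fin 3 → Fin 3 → Fin 3 → Fin 3 → ℝ}, IsBetween t b →
      b 1 1 1 1 = b 0 0 0 0 ∧ b 0 0 1 1 = b 1 1 0 0 * t ^ 4 ∧
      2 * b 0 1 0 1 = - (b 0 0 0 0 + b 1 1 0 0 * t ^ 2) := by
    intro b hb
    have a1 := (hb.edge_left ht0 0).1
    have a2 := (hb.edge_left ht0 1).2
    have a3 := (hb.edge_right ht0 0).1
    simp only [hb.symm.1 1 0, hb.symm.2 _ _ 1 0] at a1 a2 a3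
    exact ⟨by linarith, by linear_combination a1 - t ^ 2 * a3, by linarith⟩
  obtain ⟨p1, p2, p3⟩ := edge h
  obtain ⟨q1, q2, q3⟩ := edge h.rotate
  obtain ⟨r1, r2, r3⟩ := edge h.rotate.rotate
  have s1 := h.signs_left.1
  have s2 := h.rotate.signs_left.1
  have w1 := h.signs_right
  have w2 := h.rotate.signs_right
  simp [h.symm.2 _ _ 1 0, h.symm.2 _ _ 2 0, h.symm.1 1 0, h.symm.1 2 0] at q1 q2 q3 r1 r2 r3 s1 s2 w1 w2
  have ht4 : t ^ 4 - 1 ≠ 0 := by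
    have : t ^ 4 - 1 = (t ^ 2 - 1) * (t ^ 2 + 1) := by ring
    exact this ▸ mul_ne_zero (sub_ne_zero.2 ht1) (by positivity)
  have u3 : c 0 0 2 2 = c 1 1 0 0 :=
    mul_left_cancel₀ ht4 (by linear_combination w1 - s1 + p2 - r2)
  have u2 : c 2 2 1 1 = c 1 1 0 0 :=
    mul_left_cancel₀ ht4 (by linear_combination s2 - w2 + p2 - q2)
  rw [u2] at q2 q3
  rw [u3] at r2 r3
  have a : c 0 0 0 0 = c 1 1 0 0 * (t ^ 2 - 1) ^ 2 := by
    linear_combination p3 + r3 + p2 + u3 - s1 + r1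
  have a' : c 1 1 1 1 = c 1 1 0 0 * (t ^ 2 - 1) ^ 2 := p1.trans a
  refine ⟨⟨a, a', q1.trans a'⟩, ⟨u2, u3⟩, ⟨p2, q2, r2⟩, ?_, ?_, ?_⟩
  · linear_combination p3 - a
  · linear_combination r3 - q1 - a'
  · linear_combination q3 - a'

lemma eq_mul_ptFun (h : IsBetween t c) (ht0 : t ≠ 0) (ht1 : t ^ 2 ≠ 1) (x y : Fin 3 → ℝ) :
    tensorForm c x y = c 1 1 0 0 * ptFun t x y := by
  obtain ⟨⟨a1, a2, a3⟩, ⟨b1, b2⟩, ⟨d1, d2, d3⟩, e1, e2, e3⟩ := h.even_coeffs ht0 ht1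
  obtain ⟨⟨p1, p2, p3, p4⟩, p5, p6, p7, p8⟩ := h.mixed_eq_zero ht0 ht1
  obtain ⟨⟨q1, q2, q3, q4⟩, q5, q6, q7, q8⟩ := h.rotate.mixed_eq_zero ht0 ht1
  obtain ⟨⟨r1, r2, r3, r4⟩, r5, r6, r7, r8⟩ := h.rotate.rotate.mixed_eq_zero ht0 ht1
  simp [h.symm.2 _ _ 1 0, h.symm.2 _ _ 2 0, h.symm.2 _ _ 2 1,
    h.symm.1 1 0, h.symm.1 2 0, h.symm.1 2 1] at q1 q2 q3 q4 q5 q6 q7 q8 r1 r2 r3 r4 r5 r6 r7 r8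
  simp only [tensorForm, ptFun, Fin.sum_univ_three, h.symm.2 _ _ 1 0, h.symm.2 _ _ 2 0,
    h.symm.2 _ _ 2 1, h.symm.1 1 0, h.symm.1 2 0, h.symm.1 2 1, a1, a2, a3, b1, b2, d1, d2, d3,
    p1, p2, p3, p4, p5, p6, p7, p8, q1, q2, q3, q4, q5, q6, q7, q8,
    r1, r2, r3, r4, r5, r6, r7, r8]
  linear_combination 2 * (x 0 * x 1 * y 0 * y 1) * e1 + 2 * (x 0 * x 2 * y 0 * y 2) * e2 +
    2 * (x 1 * x 2 * y 1 * y 2) * e3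

end IsBetween

lemma IsBiquadratic.eq_smul_Pt {q r : MvPolynomial (Fin 3 ⊕ Fin 3) ℝ} (hq : IsBiquadratic q)
    (hq0 : ∀ x y : Fin 3 → ℝ, 0 ≤ eval (Sum.elim x y) q)
    (hr0 : ∀ x y : Fin 3 → ℝ, 0 ≤ eval (Sum.elim x y) r)
    (hsum : Pt t = q + r) (ht0 : t ≠ 0) (ht1 : t ^ 2 ≠ 1) :
    ∃ l : ℝ, 0 ≤ l ∧ q = l • Pt t := by
  obtain ⟨c, hc, hcq⟩ := hq.exists_tensor
  have h : IsBetween t c := ⟨hc, fun x y => hcq x y ▸ hq0 x y, fun x y => by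
    rw [← hcq, ← eval_Pt, hsum, map_add]
    exact le_add_of_nonneg_right (hr0 x y)⟩
  refine ⟨c 1 1 0 0, ?_, MvPolynomial.funext fun z => ?_⟩
  · have := h.nonneg ![0, 1, 0] ![1, 0, 0]
    rw [h.eq_mul_ptFun ht0 ht1] at this
    simpa [ptFun] using this
  · rw [← Sum.elim_comp_inl_inr z, hcq, h.eq_mul_ptFun ht0 ht1, smul_eval, eval_Pt]

end

/-- For `t ∉ {-1, 0, 1}`, the form `p_t` is extremal in the convex cone of nonnegative
biquadratic forms: in any decomposition `p_t = q + r` into nonnegative biquadratic forms,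
both summands are nonnegative scalar multiples of `p_t`. -/
theorem pt_extremal (t : ℝ) (ht : t ∉ ({-1, 0, 1} : Set ℝ))
    (q r : MvPolynomial (Fin 3 ⊕ Fin 3) ℝ) (hq : IsBiquadratic q) (hr : IsBiquadratic r)
    (hq0 : ∀ x y : Fin 3 → ℝ, 0 ≤ eval (Sum.elim x y) q)
    (hr0 : ∀ x y : Fin 3 → ℝ, 0 ≤ eval (Sum.elim x y) r)
    (hsum : Pt t = q + r) :
    ∃ l m : ℝ, 0 ≤ l ∧ 0 ≤ m ∧ q = l • Pt t ∧ r = m • Pt t := by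
  simp only [Set.mem_insert_iff, Set.mem_singleton_iff, not_or] at ht
  have ht1 : t ^ 2 ≠ 1 := fun h =>
    (sq_eq_sq_iff_eq_or_eq_neg.1 (h.trans (one_pow 2).symm)).elim ht.2.2 ht.1
  obtain ⟨l, hl, hql⟩ := hq.eq_smul_Pt hq0 hr0 hsum ht.2.1 ht1
  obtain ⟨m, hm, hrm⟩ := hr.eq_smul_Pt hr0 hq0 (hsum.trans (add_comm q r)) ht.2.1 ht1
  exact ⟨l, m, hl, hm, hql, hrm⟩
end

section
/- Let t ∈ ℝ with t ∉ {−1,0,1}. The map Φ_t is extremal in the convex cone of positive linear maps on real symmetric 3×3 matrices: if Ψ₁ and Ψ₂ are linear maps from real symmetric 3×3 matrices to real symmetric 3×3 matrices that map every positive semidefinite matrix to a positive semidefinite matrix, and Φ_t = Ψ₁ + Ψ₂, then there exist real numbers λ, μ ≥ 0 with Ψ₁ = λ·Φ_t and Ψ₂ = μ·Φ_t. -/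
open Matrix

/-- The space of real symmetric `3 × 3` matrices. -/
def Sym3 : Submodule ℝ (Matrix (Fin 3) (Fin 3) ℝ) where
  carrier := {A | A.IsSymm}
  add_mem' := fun ha hb => ha.add hb
  zero_mem' := Matrix.isSymm_zero
  smul_mem' := fun c _ hA => hA.smul c

/-- The map `Φ_t` applied to a `3 × 3` matrix `A`. -/
def Phi (t : ℝ) (A : Matrix (Fin 3) (Fin 3) ℝ) : Matrix (Fin 3) (Fin 3) ℝ :=
  !![(t^2-1)^2 * A 0 0 + A 1 1 + t^4 * A 2 2, -(t^4-t^2+1) * A 0 1, -(t^4-t^2+1) * A 0 2;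
     -(t^4-t^2+1) * A 1 0, (t^2-1)^2 * A 1 1 + A 2 2 + t^4 * A 0 0, -(t^4-t^2+1) * A 1 2;
     -(t^4-t^2+1) * A 2 0, -(t^4-t^2+1) * A 2 1, (t^2-1)^2 * A 2 2 + A 0 0 + t^4 * A 1 1]

lemma phi_isSymm (t : ℝ) {A : Matrix (Fin 3) (Fin 3) ℝ} (hA : A.IsSymm) :
    (Phi t A).IsSymm := by
  have h01 := hA.apply 0 1
  have h02 := hA.apply 0 2
  have h12 := hA.apply 1 2
  apply Matrix.IsSymm.ext
  intro i j
  fin_cases i <;> fin_cases j <;> simp [Phi, h01, h02, h12]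

/-- `Φ_t` as a linear map on the space of real symmetric `3 × 3` matrices. -/
def PhiL (t : ℝ) : Sym3 →ₗ[ℝ] Sym3 where
  toFun A := ⟨Phi t A.1, phi_isSymm t A.2⟩
  map_add' A B := by
    apply Subtype.ext
    ext i j
    fin_cases i <;> fin_cases j <;> simp [Phi] <;> ring
  map_smul' c A := by
    apply Subtype.ext
    ext i j
    fin_cases i <;> fin_cases j <;> simp [Phi] <;> ring

/-- A zero of a nonnegative ternary quadratic form is a critical point. -/
lemma sum_mul_eq_zero_of_quadratic_nonneg {S : Fin 3 → Fin 3 → ℝ}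
    (hS : ∀ k l, S k l = S l k)
    (h : ∀ x : Fin 3 → ℝ, 0 ≤ ∑ k, ∑ l, S k l * x k * x l) {x : Fin 3 → ℝ}
    (hx : ∑ k, ∑ l, S k l * x k * x l = 0) (k : Fin 3) : ∑ l, S k l * x l = 0 := by
  have key : ∀ e : ℝ, 0 ≤ S k k * (e * e) + (2 * ∑ l, S k l * x l) * e + 0 := by
    intro e
    have h1 := h (x + e • Pi.single k 1)
    have h10 := hS 1 0
    have h20 := hS 2 0
    have h21 := hS 2 1
    fin_cases k <;>
      simp [Fin.sum_univ_three, Pi.single_apply, h10, h20, h21] at h1 hx ⊢ <;>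
      linarith
  have hd := discrim_le_zero key
  rw [discrim] at hd
  nlinarith [sq_nonneg (∑ l, S k l * x l)]

/-- The biquadratic form of a map on symmetric matrices. -/
def biquadratic (T : Fin 3 → Fin 3 → Fin 3 → Fin 3 → ℝ) (x y : Fin 3 → ℝ) : ℝ :=
  ∑ k, ∑ l, ∑ i, ∑ j, T k l i j * x k * x l * y i * y j

/-- The biquadratic form of `Φ_t`. -/
def phiForm (t : ℝ) (x y : Fin 3 → ℝ) : ℝ :=
  (t ^ 2 - 1) ^ 2 * (x 0 ^ 2 * y 0 ^ 2 + x 1 ^ 2 * y 1 ^ 2 + x 2 ^ 2 * y 2 ^ 2) +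
    (x 1 ^ 2 * y 0 ^ 2 + x 2 ^ 2 * y 1 ^ 2 + x 0 ^ 2 * y 2 ^ 2) +
    t ^ 4 * (x 2 ^ 2 * y 0 ^ 2 + x 0 ^ 2 * y 1 ^ 2 + x 1 ^ 2 * y 2 ^ 2) -
    2 * (t ^ 4 - t ^ 2 + 1) *
      (x 0 * x 1 * y 0 * y 1 + x 0 * x 2 * y 0 * y 2 + x 1 * x 2 * y 1 * y 2)

/-- The form with coefficients `T` is critical at all zeros of the form of `Φ_t`. -/
structure IsCritical (t : ℝ) (T : Fin 3 → Fin 3 → Fin 3 → Fin 3 → ℝ) : Prop where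
  symm_left : ∀ k l i j, T k l i j = T l k i j
  symm_right : ∀ k l i j, T k l i j = T k l j i
  grad_left : ∀ x y, phiForm t x y = 0 → ∀ k, ∑ l, ∑ i, ∑ j, T k l i j * x l * y i * y j = 0
  grad_right : ∀ x y, phiForm t x y = 0 → ∀ i, ∑ k, ∑ l, ∑ j, T k l i j * x k * x l * y j = 0

lemma isCritical_of_nonneg_of_le {t c : ℝ} {T : Fin 3 → Fin 3 → Fin 3 → Fin 3 → ℝ}
    (hl : ∀ k l i j, T k l i j = T l k i j) (hr : ∀ k l i j, T k l i j = T k l j i)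
    (h0 : ∀ x y, 0 ≤ biquadratic T x y) (h1 : ∀ x y, biquadratic T x y ≤ c * phiForm t x y) :
    IsCritical t T where
  symm_left := hl
  symm_right := hr
  grad_left x y hxy k := by
    have e : ∀ z, ∑ k, ∑ l, (∑ i, ∑ j, T k l i j * y i * y j) * z k * z l
        = biquadratic T z y := by
      intro z
      simp only [biquadratic, Finset.sum_mul]
      refine Finset.sum_congr rfl fun k _ => Finset.sum_congr rfl fun l _ =>
        Finset.sum_congr rfl fun i _ => Finset.sum_congr rfl fun j _ => by ring
    have hz : biquadratic T x y = 0 :=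
      le_antisymm ((h1 x y).trans_eq (by rw [hxy, mul_zero])) (h0 x y)
    have := sum_mul_eq_zero_of_quadratic_nonneg
      (S := fun k l => ∑ i, ∑ j, T k l i j * y i * y j)
      (fun k l => by simp only [hl k l]) (fun z => by rw [e]; exact h0 z y)
      (x := x) (by rw [e, hz]) k
    rw [← this]
    simp only [Finset.sum_mul]
    refine Finset.sum_congr rfl fun l _ => Finset.sum_congr rfl fun i _ =>
      Finset.sum_congr rfl fun j _ => by ring
  grad_right x y hxy i := by
    have e : ∀ z, ∑ i, ∑ j, (∑ k, ∑ l, T k l i j * x k * x l) * z i * z j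
        = biquadratic T x z := by
      intro z
      simp only [biquadratic, Fin.sum_univ_three]
      ring
    have hz : biquadratic T x y = 0 :=
      le_antisymm ((h1 x y).trans_eq (by rw [hxy, mul_zero])) (h0 x y)
    have := sum_mul_eq_zero_of_quadratic_nonneg
      (S := fun i j => ∑ k, ∑ l, T k l i j * x k * x l)
      (fun i j => by simp only [hr _ _ i j]) (fun z => by rw [e]; exact h0 x z)
      (x := y) (by rw [e, hz]) i
    rw [← this]
    simp only [Fin.sum_univ_three]
    ring

namespace IsCritical

variable {t : ℝ} {T : Fin 3 → Fin 3 → Fin 3 → Fin 3 → ℝ}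

lemma rotate (h : IsCritical t T) :
    IsCritical t (fun k l i j => T (k + 1) (l + 1) (i + 1) (j + 1)) where
  symm_left k l i j := h.symm_left _ _ _ _
  symm_right k l i j := h.symm_right _ _ _ _
  grad_left x y hxy k := by
    have := h.grad_left ![x 2, x 0, x 1] ![y 2, y 0, y 1]
      (by rw [← hxy]; simp [phiForm]; ring) (k + 1)
    rw [← this]
    simp [Fin.sum_univ_three]
    ring
  grad_right x y hxy i := by
    have := h.grad_right ![x 2, x 0, x 1] ![y 2, y 0, y 1]
      (by rw [← hxy]; simp [phiForm]; ring) (i + 1)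
    rw [← this]
    simp [Fin.sum_univ_three]
    ring

/-- The relations among the coefficients of squares coming from the zeros in a coordinate plane. -/
lemma even_relations (h : IsCritical t T) (ht : t ≠ 0) :
    T 0 0 0 0 = T 1 1 1 1 ∧
    T 0 0 1 1 = t ^ 2 * (-2 * T 0 1 0 1 - T 0 0 0 0) ∧
    t ^ 2 * T 1 1 0 0 = -2 * T 0 1 0 1 - T 0 0 0 0 ∧
    T 0 0 0 0 + T 0 0 1 1 + T 0 0 2 2 + 2 * T 0 1 0 1 + 2 * T 0 2 0 2 = 0 := by
  have a1 : ∀ i j, T 1 0 i j = T 0 1 i j := fun i j => h.symm_left _ _ _ _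
  have a2 : ∀ i j, T 2 0 i j = T 0 2 i j := fun i j => h.symm_left _ _ _ _
  have a3 : ∀ i j, T 2 1 i j = T 1 2 i j := fun i j => h.symm_left _ _ _ _
  have b1 : ∀ i j, T i j 1 0 = T i j 0 1 := fun i j => h.symm_right _ _ _ _
  have b2 : ∀ i j, T i j 2 0 = T i j 0 2 := fun i j => h.symm_right _ _ _ _
  have b3 : ∀ i j, T i j 2 1 = T i j 1 2 := fun i j => h.symm_right _ _ _ _
  have z1 : phiForm t ![1, t, 0] ![t, 1, 0] = 0 := by simp [phiForm]; ring
  have z2 : phiForm t ![1, -t, 0] ![-t, 1, 0] = 0 := by simp [phiForm]; ring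
  have u1 : phiForm t ![1, 1, 1] ![1, 1, 1] = 0 := by simp [phiForm]; ring
  have u2 : phiForm t ![1, 1, -1] ![1, 1, -1] = 0 := by simp [phiForm]; ring
  have u3 : phiForm t ![1, -1, 1] ![1, -1, 1] = 0 := by simp [phiForm]; ring
  have u4 : phiForm t ![1, -1, -1] ![1, -1, -1] = 0 := by simp [phiForm]; ring
  have c1 := h.grad_left _ _ z1 0
  have c2 := h.grad_left _ _ z2 0
  have c3 := h.grad_left _ _ z1 1
  have c4 := h.grad_left _ _ z2 1
  have c5 := h.grad_right _ _ z1 0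
  have c6 := h.grad_right _ _ z2 0
  have d1 := h.grad_left _ _ u1 0
  have d2 := h.grad_left _ _ u2 0
  have d3 := h.grad_left _ _ u3 0
  have d4 := h.grad_left _ _ u4 0
  simp [Fin.sum_univ_three, a1, a2, a3, b1, b2, b3] at c1 c2 c3 c4 c5 c6 d1 d2 d3 d4
  have e1 : T 0 0 0 0 * t ^ 2 + T 0 0 1 1 + 2 * T 0 1 0 1 * t ^ 2 = 0 := by
    linear_combination (c1 + c2) / 2
  have e2 : T 1 1 0 0 * t ^ 2 + T 1 1 1 1 + 2 * T 0 1 0 1 = 0 := by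
    apply mul_left_cancel₀ ht
    linear_combination (c3 - c4) / 2
  have e3 : T 0 0 0 0 + T 1 1 0 0 * t ^ 2 + 2 * T 0 1 0 1 = 0 := by
    apply mul_left_cancel₀ ht
    linear_combination (c5 - c6) / 2
  refine ⟨by linarith, by linarith, by linarith, ?_⟩
  linarith

/-- The coefficients which change sign with both `x₀y₀` and `x₁y₁` vanish. -/
lemma odd_relations (h : IsCritical t T) (ht : t ≠ 0) (ht1 : t ^ 2 - 1 ≠ 0) :
    (∀ k, T 0 1 k k = 0) ∧ (∀ k, T k k 0 1 = 0) ∧ T 0 2 1 2 = 0 ∧ T 1 2 0 2 = 0 := by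
  have a1 : ∀ i j, T 1 0 i j = T 0 1 i j := fun i j => h.symm_left _ _ _ _
  have a2 : ∀ i j, T 2 0 i j = T 0 2 i j := fun i j => h.symm_left _ _ _ _
  have a3 : ∀ i j, T 2 1 i j = T 1 2 i j := fun i j => h.symm_left _ _ _ _
  have b1 : ∀ i j, T i j 1 0 = T i j 0 1 := fun i j => h.symm_right _ _ _ _
  have b2 : ∀ i j, T i j 2 0 = T i j 0 2 := fun i j => h.symm_right _ _ _ _
  have b3 : ∀ i j, T i j 2 1 = T i j 1 2 := fun i j => h.symm_right _ _ _ _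
  have z1 : phiForm t ![1, t, 0] ![t, 1, 0] = 0 := by simp [phiForm]; ring
  have z2 : phiForm t ![1, -t, 0] ![-t, 1, 0] = 0 := by simp [phiForm]; ring
  have v1 : phiForm t ![0, 1, t] ![0, t, 1] = 0 := by simp [phiForm]; ring
  have v2 : phiForm t ![0, 1, -t] ![0, -t, 1] = 0 := by simp [phiForm]; ring
  have w1 : phiForm t ![t, 0, 1] ![1, 0, t] = 0 := by simp [phiForm]; ring
  have w2 : phiForm t ![-t, 0, 1] ![1, 0, -t] = 0 := by simp [phiForm]; ring
  have u1 : phiForm t ![1, 1, 1] ![1, 1, 1] = 0 := by simp [phiForm]; ring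
  have u2 : phiForm t ![1, 1, -1] ![1, 1, -1] = 0 := by simp [phiForm]; ring
  have u3 : phiForm t ![1, -1, 1] ![1, -1, 1] = 0 := by simp [phiForm]; ring
  have u4 : phiForm t ![1, -1, -1] ![1, -1, -1] = 0 := by simp [phiForm]; ring
  have c1 := h.grad_left _ _ z1 0
  have c2 := h.grad_left _ _ z2 0
  have c3 := h.grad_left _ _ z1 1
  have c4 := h.grad_left _ _ z2 1
  have c5 := h.grad_right _ _ z1 0
  have c6 := h.grad_right _ _ z2 0
  have f1 := h.grad_left _ _ v1 0
  have f2 := h.grad_left _ _ v2 0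
  have f3 := h.grad_right _ _ v1 0
  have f4 := h.grad_right _ _ v2 0
  have g1 := h.grad_left _ _ w1 1
  have g2 := h.grad_left _ _ w2 1
  have d1 := h.grad_left _ _ u1 0
  have d2 := h.grad_left _ _ u2 0
  have d3 := h.grad_left _ _ u3 0
  have d4 := h.grad_left _ _ u4 0
  have k1 := h.grad_left _ _ u1 2
  have k2 := h.grad_left _ _ u2 2
  have k3 := h.grad_left _ _ u3 2
  have k4 := h.grad_left _ _ u4 2
  have m1 := h.grad_right _ _ u1 2
  have m2 := h.grad_right _ _ u2 2
  have m3 := h.grad_right _ _ u3 2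
  have m4 := h.grad_right _ _ u4 2
  simp [Fin.sum_univ_three, a1, a2, a3, b1, b2, b3] at c1 c2 c3 c4 c5 c6 f1 f2 f3 f4 g1 g2 d1 d2 d3 d4 k1 k2 k3 k4 m1 m2 m3 m4
  have e1 : T 0 1 0 0 * t ^ 2 + T 0 1 1 1 + 2 * T 0 0 0 1 = 0 := by
    apply mul_left_cancel₀ ht
    linear_combination (c1 - c2) / 2
  have e2 : T 0 1 0 0 * t ^ 2 + T 0 1 1 1 + 2 * t ^ 2 * T 1 1 0 1 = 0 := by
    linear_combination (c3 + c4) / 2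
  have e3 : 2 * t ^ 2 * T 0 1 0 0 + T 0 0 0 1 + T 1 1 0 1 * t ^ 2 = 0 := by
    linear_combination (c5 + c6) / 2
  have e4 : T 0 1 1 1 * t ^ 2 + T 0 1 2 2 + 2 * T 0 2 1 2 * t ^ 2 = 0 := by
    linear_combination (f1 + f2) / 2
  have e5 : T 1 1 0 1 + T 2 2 0 1 * t ^ 2 + 2 * T 1 2 0 2 = 0 := by
    apply mul_left_cancel₀ ht
    linear_combination (f3 - f4) / 2
  have e6 : T 0 1 0 0 + T 0 1 2 2 * t ^ 2 + 2 * T 1 2 0 2 = 0 := by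
    apply mul_left_cancel₀ ht
    linear_combination (g1 - g2) / 2
  have e7 : T 0 1 0 0 + T 0 1 1 1 + T 0 1 2 2 + 2 * T 0 0 0 1 + 2 * T 0 2 1 2 = 0 := by
    linear_combination (d1 + d2 - d3 - d4) / 4
  have e8 : T 2 2 0 1 = T 0 1 2 2 := by
    linear_combination (k1 - k2 - k3 + k4 - (m1 - m2 - m3 + m4)) / 8
  have ht2 : t ^ 2 ≠ 0 := pow_ne_zero 2 ht
  have q0 : T 0 0 0 1 = t ^ 2 * T 1 1 0 1 := by linarith
  have p0 : T 0 1 0 0 = -T 1 1 0 1 := by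
    apply mul_left_cancel₀ ht2
    linarith
  have q1 : T 1 1 0 1 = 0 := by
    rw [e8] at e5
    linarith
  rw [q1] at q0 p0
  simp only [mul_zero, neg_zero] at q0 p0
  simp only [q1, q0, p0, e8, mul_zero, zero_mul, zero_add, add_zero] at e1 e5 e4 e7
  simp only [e1, zero_mul, zero_add] at e4 e7
  have p2 : T 0 1 2 2 = 0 := by
    apply mul_left_cancel₀ ht1
    linear_combination t ^ 2 * e7 - e4
  simp only [p2, zero_mul, zero_add] at e5 e7 e8
  refine ⟨fun k => ?_, fun k => ?_, by linarith, by linarith⟩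
  · fin_cases k <;> assumption
  · fin_cases k <;> assumption

/-- A form critical at the zeros of the form of `Φ_t` is a multiple of it. -/
lemma eq_mul (h : IsCritical t T) (ht : t ≠ 0) (ht1 : t ^ 2 - 1 ≠ 0) {c : ℝ}
    (hc : T 0 0 0 0 = c * (t ^ 2 - 1) ^ 2) (A : Fin 3 → Fin 3 → ℝ) (hA : ∀ i j, A i j = A j i)
    (i j : Fin 3) : ∑ k, ∑ l, A k l * T k l i j = c * Phi t A i j := by
  have a1 : ∀ i j, T 1 0 i j = T 0 1 i j := fun i j => h.symm_left _ _ _ _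
  have a2 : ∀ i j, T 2 0 i j = T 0 2 i j := fun i j => h.symm_left _ _ _ _
  have a3 : ∀ i j, T 2 1 i j = T 1 2 i j := fun i j => h.symm_left _ _ _ _
  have b1 : ∀ i j, T i j 1 0 = T i j 0 1 := fun i j => h.symm_right _ _ _ _
  have b2 : ∀ i j, T i j 2 0 = T i j 0 2 := fun i j => h.symm_right _ _ _ _
  have b3 : ∀ i j, T i j 2 1 = T i j 1 2 := fun i j => h.symm_right _ _ _ _
  obtain ⟨p, q, r, s⟩ := h.odd_relations ht ht1
  obtain ⟨p', q', r', s'⟩ := h.rotate.odd_relations ht ht1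
  obtain ⟨p'', q'', r'', s''⟩ := h.rotate.rotate.odd_relations ht ht1
  obtain ⟨x1, x2, x3, x4⟩ := h.even_relations ht
  obtain ⟨y1, y2, y3, y4⟩ := h.rotate.even_relations ht
  obtain ⟨z1, z2, z3, z4⟩ := h.rotate.rotate.even_relations ht
  simp only [Fin.isValue, zero_add, Fin.reduceAdd, a1, a2, a3, b1, b2, b3]
    at p q r s p' q' r' s' p'' q'' r'' s'' x1 x2 x3 x4 y1 y2 y3 y4 z1 z2 z3 z4
  have n1 : t ^ 2 * T 1 1 0 0 - T 0 0 2 2 = c * (t ^ 2 - 1) := by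
    apply mul_left_cancel₀ ht1
    linear_combination x4 - x2 + (t ^ 2 - 1) * x3 - z3 + z1 + hc
  have n2 : t ^ 2 * T 2 2 1 1 - T 1 1 0 0 = c * (t ^ 2 - 1) := by
    apply mul_left_cancel₀ ht1
    linear_combination y4 - y2 + (t ^ 2 - 1) * y3 - x3 + hc
  have n3 : t ^ 2 * T 0 0 2 2 - T 2 2 1 1 = c * (t ^ 2 - 1) := by
    apply mul_left_cancel₀ ht1
    linear_combination z4 - z2 + (t ^ 2 - 1) * z3 - y3 - x1 + hc
  have hα : T 1 1 0 0 = c := by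
    apply mul_left_cancel₀ (mul_ne_zero ht1 (by positivity : t ^ 4 + t ^ 2 + 1 ≠ 0))
    linear_combination t ^ 4 * n1 + n2 + t ^ 2 * n3
  have hγ : T 0 0 2 2 = c := by linear_combination t ^ 2 * hα - n1
  have hβ : T 2 2 1 1 = c := by linear_combination t ^ 2 * hγ - n3
  have m1 : T 0 1 0 1 = -c * (t ^ 4 - t ^ 2 + 1) / 2 := by
    linear_combination (x3 - t ^ 2 * hα - hc) / 2
  have m2 : T 1 2 1 2 = -c * (t ^ 4 - t ^ 2 + 1) / 2 := by
    linear_combination (y3 - t ^ 2 * hβ - hc + x1) / 2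
  have m3 : T 0 2 0 2 = -c * (t ^ 4 - t ^ 2 + 1) / 2 := by
    linear_combination (z3 - t ^ 2 * hγ - hc - z1) / 2
  have o1 : T 0 0 1 1 = c * t ^ 4 := by linear_combination x2 + t ^ 2 * (t ^ 2 * hα - x3)
  have o2 : T 1 1 2 2 = c * t ^ 4 := by linear_combination y2 + t ^ 2 * (t ^ 2 * hβ - y3)
  have o3 : T 2 2 0 0 = c * t ^ 4 := by linear_combination z2 + t ^ 2 * (t ^ 2 * hγ - z3)
  have d1 : T 1 1 1 1 = c * (t ^ 2 - 1) ^ 2 := x1 ▸ hc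
  have d2 : T 2 2 2 2 = c * (t ^ 2 - 1) ^ 2 := y1 ▸ d1
  have A10 := hA 1 0
  have A20 := hA 2 0
  have A21 := hA 2 1
  have p0 := p 0
  have p1 := p 1
  have p2 := p 2
  have q0 := q 0
  have q1 := q 1
  have q2 := q 2
  have p0' := p' 0
  have p1' := p' 1
  have p2' := p' 2
  have q0' := q' 0
  have q1' := q' 1
  have q2' := q' 2
  have p0'' := p'' 0
  have p1'' := p'' 1
  have p2'' := p'' 2
  have q0'' := q'' 0
  have q1'' := q'' 1
  have q2'' := q'' 2
  simp only [Fin.isValue, zero_add, Fin.reduceAdd] at p0 p1 p2 q0 q1 q2 p0' p1' p2' q0' q1' q2' p0'' p1'' p2'' q0'' q1'' q2''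
  fin_cases i <;> fin_cases j <;>
    simp [Fin.sum_univ_three, Phi, *] <;> ring

end IsCritical

/-- The symmetric matrix `E_kl + E_lk`. -/
def symSingle (k l : Fin 3) : Sym3 :=
  ⟨single k l 1 + single l k 1, by
    change IsSymm _
    rw [IsSymm, transpose_add, transpose_single, transpose_single, add_comm]⟩

/-- The coefficients of a linear map on symmetric matrices. -/
def coeffs (Ψ : Sym3 →ₗ[ℝ] Sym3) (k l i j : Fin 3) : ℝ := (Ψ (symSingle k l)).1 i j

lemma eq_sum_smul_symSingle (A : Sym3) : A = ∑ k, ∑ l, (A.1 k l / 2) • symSingle k l := by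
  have h : ∀ i j, A.1 i j = A.1 j i := fun i j => A.2.apply j i
  apply Subtype.ext
  ext i j
  have h10 := h 1 0
  have h20 := h 2 0
  have h21 := h 2 1
  fin_cases i <;> fin_cases j <;>
    simp [Fin.sum_univ_three, symSingle, h10, h20, h21]

lemma apply_eq_sum_coeffs (Ψ : Sym3 →ₗ[ℝ] Sym3) (A : Sym3) (i j : Fin 3) :
    (Ψ A).1 i j = ∑ k, ∑ l, A.1 k l / 2 * coeffs Ψ k l i j := by
  conv_lhs => rw [eq_sum_smul_symSingle A]
  simp [map_sum, Matrix.sum_apply, coeffs]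

/-- The rank-one matrix `x xᵀ`. -/
def symRankOne (x : Fin 3 → ℝ) : Sym3 :=
  ⟨vecMulVec x x, transpose_vecMulVec x x⟩

lemma posSemidef_symRankOne (x : Fin 3 → ℝ) :
    (symRankOne x : Matrix (Fin 3) (Fin 3) ℝ).PosSemidef := by
  change (vecMulVec x x).PosSemidef
  simpa using posSemidef_vecMulVec_self_star x

lemma biquadratic_coeffs (Ψ : Sym3 →ₗ[ℝ] Sym3) (x y : Fin 3 → ℝ) :
    biquadratic (coeffs Ψ) x y = 2 * (y ⬝ᵥ (Ψ (symRankOne x)).1 *ᵥ y) := by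
  simp only [dotProduct, mulVec, apply_eq_sum_coeffs, biquadratic, symRankOne, vecMulVec_apply,
    Fin.sum_univ_three]
  ring

lemma dotProduct_phiL_mulVec (t : ℝ) (x y : Fin 3 → ℝ) :
    y ⬝ᵥ (PhiL t (symRankOne x)).1 *ᵥ y = phiForm t x y := by
  simp [dotProduct, mulVec, PhiL, Phi, symRankOne, vecMulVec_apply, phiForm, Fin.sum_univ_three]
  ring

lemma exists_eq_smul_phiL {t : ℝ} (ht : t ≠ 0) (ht1 : t ^ 2 - 1 ≠ 0) {Ψ Ψ' : Sym3 →ₗ[ℝ] Sym3}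
    (h : ∀ A : Sym3, (A : Matrix (Fin 3) (Fin 3) ℝ).PosSemidef →
      (Ψ A : Matrix (Fin 3) (Fin 3) ℝ).PosSemidef)
    (h' : ∀ A : Sym3, (A : Matrix (Fin 3) (Fin 3) ℝ).PosSemidef →
      (Ψ' A : Matrix (Fin 3) (Fin 3) ℝ).PosSemidef)
    (hsum : PhiL t = Ψ + Ψ') : ∃ l : ℝ, 0 ≤ l ∧ Ψ = l • PhiL t := by
  have h0 : ∀ x y, 0 ≤ y ⬝ᵥ (Ψ (symRankOne x)).1 *ᵥ y := fun x y => by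
    simpa using (h _ (posSemidef_symRankOne x)).dotProduct_mulVec_nonneg y
  have h0' : ∀ x y, 0 ≤ y ⬝ᵥ (Ψ' (symRankOne x)).1 *ᵥ y := fun x y => by
    simpa using (h' _ (posSemidef_symRankOne x)).dotProduct_mulVec_nonneg y
  have hadd : ∀ x y, phiForm t x y =
      y ⬝ᵥ (Ψ (symRankOne x)).1 *ᵥ y + y ⬝ᵥ (Ψ' (symRankOne x)).1 *ᵥ y := fun x y => by
    rw [← dotProduct_phiL_mulVec, hsum, ← dotProduct_add, ← add_mulVec]
    rfl
  have hcrit : IsCritical t (coeffs Ψ) := by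
    refine isCritical_of_nonneg_of_le (c := 2) (fun k l i j => ?_)
      (fun k l i j => (Ψ (symSingle k l)).2.apply j i) (fun x y => ?_) (fun x y => ?_)
    · have : symSingle k l = symSingle l k := Subtype.ext (add_comm _ _)
      rw [coeffs, coeffs, this]
    · rw [biquadratic_coeffs]
      linarith [h0 x y]
    · rw [biquadratic_coeffs, hadd]
      linarith [h0' x y]
  have ht2 : (t ^ 2 - 1) ^ 2 ≠ 0 := pow_ne_zero 2 ht1
  have h00 : 0 ≤ coeffs Ψ 0 0 0 0 := by
    have := h0 (Pi.single 0 1) (Pi.single 0 1)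
    have e := biquadratic_coeffs Ψ (Pi.single 0 1) (Pi.single 0 1)
    simp [biquadratic, Fin.sum_univ_three] at e
    simp at this
    linarith
  refine ⟨coeffs Ψ 0 0 0 0 / (t ^ 2 - 1) ^ 2 / 2, by positivity, ?_⟩
  ext A i j
  have e := hcrit.eq_mul ht ht1 (div_mul_cancel₀ _ ht2).symm A.1 (fun i j => A.2.apply j i) i j
  rw [apply_eq_sum_coeffs]
  simp only [div_mul_eq_mul_div, ← Finset.sum_div, e]
  simp [PhiL]
  ring

/-- For `t ∉ {-1, 0, 1}`, the map `Φ_t` is extremal in the convex cone of positive linear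
maps on real symmetric `3 × 3` matrices. -/
theorem phi_extremal (t : ℝ) (ht : t ∉ ({-1, 0, 1} : Set ℝ))
    (Ψ₁ Ψ₂ : Sym3 →ₗ[ℝ] Sym3)
    (h₁ : ∀ A : Sym3, (A : Matrix (Fin 3) (Fin 3) ℝ).PosSemidef →
      ((Ψ₁ A : Matrix (Fin 3) (Fin 3) ℝ)).PosSemidef)
    (h₂ : ∀ A : Sym3, (A : Matrix (Fin 3) (Fin 3) ℝ).PosSemidef →
      ((Ψ₂ A : Matrix (Fin 3) (Fin 3) ℝ)).PosSemidef)
    (hsum : PhiL t = Ψ₁ + Ψ₂) :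
    ∃ l m : ℝ, 0 ≤ l ∧ 0 ≤ m ∧ Ψ₁ = l • PhiL t ∧ Ψ₂ = m • PhiL t := by
  have ht0 : t ≠ 0 := fun h => ht (by simp [h])
  have ht1 : t ^ 2 - 1 ≠ 0 := fun h => ht (by
    rcases sq_eq_one_iff.mp (sub_eq_zero.mp h) with h | h <;> simp [h])
  obtain ⟨l, hl, e⟩ := exists_eq_smul_phiL ht0 ht1 h₁ h₂ hsum
  obtain ⟨m, hm, e'⟩ := exists_eq_smul_phiL ht0 ht1 h₂ h₁ (hsum.trans (add_comm _ _))
  exact ⟨l, m, hl, hm, e, e'⟩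
end

section
/- For every real number t, the generalized Robinson polynomial S_t(x₁,x₂,x₃) = t⁴(x₁⁶+x₂⁶+x₃⁶) + (t⁸−2t²)(x₁⁴x₂²+x₂⁴x₃²+x₃⁴x₁²) + (1−2t⁶)(x₁²x₂⁴+x₂²x₃⁴+x₃²x₁⁴) − 3(t⁸−2t⁶+t⁴−2t²+1)x₁²x₂²x₃² satisfies S_t(x₁,x₂,x₃) ≥ 0 for all (x₁,x₂,x₃) ∈ ℝ³. -/
/-- The cyclic cubic form obtained from the generalized Robinson polynomial by substituting the
squares of the variables is nonnegative on the part of the orthant where `c` is minimal. -/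
theorem robinson_cubic_nonneg_of_le (s : ℝ) {a b c : ℝ} (hc : 0 ≤ c) (hca : c ≤ a) (hcb : c ≤ b) :
    0 ≤ s^2 * (a^3 + b^3 + c^3)
        + (s^4 - 2*s) * (a^2 * b + b^2 * c + c^2 * a)
        + (1 - 2*s^3) * (a * b^2 + b * c^2 + c * a^2)
        - 3 * (s^4 - 2*s^3 + s^2 - 2*s + 1) * a * b * c := by
  have hp : 0 ≤ a - c := sub_nonneg.2 hca
  have hq : 0 ≤ b - c := sub_nonneg.2 hcb
  have h₁ : 0 ≤ (a - c)^2 - (a - c) * (b - c) + (b - c)^2 := by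
    nlinarith [sq_nonneg ((a - c) - (b - c)), mul_nonneg hp hq]
  have h₂ : 0 ≤ c * (s^2 - s + 1)^2 * ((a - c)^2 - (a - c) * (b - c) + (b - c)^2)
      + (s * (a - c) - (b - c))^2 * ((a - c) + s^2 * (b - c)) := by
    positivity
  convert h₂ using 1
  ring

/-- For every real `t`, the generalized Robinson polynomial `S_t` is nonnegative on `ℝ³`. -/
theorem generalized_robinson_nonneg (t x₁ x₂ x₃ : ℝ) :
    0 ≤ t^4 * (x₁^6 + x₂^6 + x₃^6)
        + (t^8 - 2*t^2) * (x₁^4 * x₂^2 + x₂^4 * x₃^2 + x₃^4 * x₁^2)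
        + (1 - 2*t^6) * (x₁^2 * x₂^4 + x₂^2 * x₃^4 + x₃^2 * x₁^4)
        - 3 * (t^8 - 2*t^6 + t^4 - 2*t^2 + 1) * x₁^2 * x₂^2 * x₃^2 := by
  rcases le_total (x₁^2) (x₂^2) with h₁₂ | h₂₁
  · rcases le_total (x₁^2) (x₃^2) with h₁₃ | h₃₁
    · linarith [robinson_cubic_nonneg_of_le (t^2) (sq_nonneg x₁) h₁₂ h₁₃]
    · linarith [robinson_cubic_nonneg_of_le (t^2) (sq_nonneg x₃) h₃₁ (h₃₁.trans h₁₂)]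
  · rcases le_total (x₂^2) (x₃^2) with h₂₃ | h₃₂
    · linarith [robinson_cubic_nonneg_of_le (t^2) (sq_nonneg x₂) h₂₃ h₂₁]
    · linarith [robinson_cubic_nonneg_of_le (t^2) (sq_nonneg x₃) (h₃₂.trans h₂₁) h₃₂]
end
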